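/- arXiv:1904.04795 — 5 statements merged into one kernel-verified Lean document; each statement's English description precedes it below -/
import Mathlib

section
/- Self-similar solutions of the fundamental model: Let α>0, let K, Γ : [0,2π] → ℝ be measurable with K·Γ ∈ L¹([0,2π]) and c := ∫₀^{2π} K(θ)Γ(θ) dθ ≠ 0. Define F(z) = z/(1+z)² and f(r,θ,t) = 2α·(Γ(θ)/c)·(1−t)^{-1}·F(r^α/(1−t)) for r > 0, θ ∈ [0,2π], t ∈ [0,1). Then f solves the fundamental model: for all r > 0, θ ∈ [0,2π] and t ∈ [0,1), ∂_t f(r,θ,t) = f(r,θ,t) · L₁₂^K(f)(r,t). -/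
open Real MeasureTheory Set Filter

noncomputable section

theorem integral_Ioi_rpow_div_add_rpow_sq {α r u : ℝ} (hα : 0 < α) (hr : 0 < r) (hu : 0 < u) :
    ∫ s in Ioi r, 2 * α * s ^ (α - 1) / (u + s ^ α) ^ 2 = 2 / (u + r ^ α) := by
  have hderiv : ∀ x ∈ Ici r, HasDerivAt (fun s : ℝ => -2 / (u + s ^ α))
      (2 * α * x ^ (α - 1) / (u + x ^ α) ^ 2) x := by
    intro x hx
    have hx0 : 0 < x := lt_of_lt_of_le hr hx
    have hne : u + x ^ α ≠ 0 := (add_pos hu (rpow_pos_of_pos hx0 α)).ne'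
    have h := (hasDerivAt_const x (-2 : ℝ)).div
      ((Real.hasDerivAt_rpow_const (p := α) (Or.inl hx0.ne')).const_add u) hne
    refine h.congr_deriv ?_
    ring
  have hpos : ∀ x ∈ Ioi r, 0 ≤ 2 * α * x ^ (α - 1) / (u + x ^ α) ^ 2 := by
    intro x hx
    have hx0 : 0 < x := lt_trans hr hx
    positivity
  have hlim : Tendsto (fun s : ℝ => -2 / (u + s ^ α)) atTop (nhds 0) :=
    (tendsto_atTop_add_const_left _ u (tendsto_rpow_atTop hα)).const_div_atTop (-2)
  rw [integral_Ioi_of_hasDerivAt_of_nonneg' hderiv hpos hlim]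
  ring

/-- Self-similar solutions of the fundamental model:
`f(r,θ,t) = 2α (Γ(θ)/c) (1-t)⁻¹ F(r^α/(1-t))` with `F(z) = z/(1+z)²` solves
`∂_t f = f · L₁₂^K(f)` on `(0,∞) × [0,2π] × [0,1)`. -/
theorem fundamental_model_self_similar
    (α : ℝ) (hα : 0 < α) (K Γ : ℝ → ℝ)
    (hK : Measurable K) (hΓ : Measurable Γ)
    (hKΓ : IntegrableOn (fun θ => K θ * Γ θ) (Icc 0 (2 * π)))
    (c : ℝ) (hc : c = ∫ θ in Icc 0 (2 * π), K θ * Γ θ) (hc0 : c ≠ 0)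
    (F : ℝ → ℝ) (hF : F = fun z => z / (1 + z) ^ 2)
    (f : ℝ → ℝ → ℝ → ℝ)
    (hf : f = fun r θ t => 2 * α * (Γ θ / c) * (1 - t)⁻¹ * F (r ^ α / (1 - t))) :
    ∀ r θ t : ℝ, 0 < r → θ ∈ Icc 0 (2 * π) → t ∈ Ico (0 : ℝ) 1 →
      HasDerivAt (fun t' => f r θ t')
        (f r θ t * ∫ s in Ioi r, ∫ θ' in Icc 0 (2 * π), K θ' * f s θ' t / s) t := by
  intro r θ t hr _ ht
  have hu : 0 < 1 - t := sub_pos.mpr ht.2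
  have hR : 0 < r ^ α := rpow_pos_of_pos hr α
  have hinner : ∀ s ∈ Ioi r, (∫ θ' in Icc 0 (2 * π), K θ' * f s θ' t / s) =
      2 * α * s ^ (α - 1) / (1 - t + s ^ α) ^ 2 := by
    intro s hs
    have hs0 : 0 < s := lt_trans hr hs
    have hS : 0 < s ^ α := rpow_pos_of_pos hs0 α
    have hfactor : ∀ θ', K θ' * f s θ' t / s = K θ' * Γ θ' *
        (2 * α / c * (1 - t)⁻¹ * F (s ^ α / (1 - t)) / s) := by
      intro θ'
      rw [hf]
      ring
    simp_rw [hfactor]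
    rw [integral_mul_const, ← hc, hF, rpow_sub_one hs0.ne']
    have h1 : 1 - t + s ^ α ≠ 0 := by positivity
    have h2 : 1 + s ^ α / (1 - t) = (1 - t + s ^ α) / (1 - t) := by field_simp
    simp only [h2]
    field_simp
  rw [setIntegral_congr_fun measurableSet_Ioi hinner,
    integral_Ioi_rpow_div_add_rpow_sq hα hr hu]
  have hform : ∀ t' < 1, f r θ t' = 2 * α * (Γ θ / c) * (r ^ α / (1 - t' + r ^ α) ^ 2) := by
    intro t' ht'
    have hu' : 0 < 1 - t' := sub_pos.mpr ht'
    have h1 : 1 - t' + r ^ α ≠ 0 := by positivity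
    have h2 : 1 + r ^ α / (1 - t') = (1 - t' + r ^ α) / (1 - t') := by field_simp
    simp only [hf, hF, h2]
    field_simp
  have hne : 1 - t + r ^ α ≠ 0 := by positivity
  have hd := ((hasDerivAt_const t (r ^ α)).div
    ((((hasDerivAt_id t).const_sub 1).add_const (r ^ α)).pow 2)
    (pow_ne_zero 2 hne)).const_mul (2 * α * (Γ θ / c))
  refine (hd.congr_of_eventuallyEq ?_).congr_deriv ?_
  · filter_upwards [Iio_mem_nhds ht.2] with t' ht'
    simpa using hform t' ht'
  · rw [hform t ht.2]
    simp
    field_simp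
end
end

section
/- The operators L₁₂ and 𝓛_Γ satisfy the intertwining identity L₁₂(𝓛_Γ(f)) = 𝓛(L₁₂(f)): if f is admissible, then for every z ≥ 0, L₁₂(𝓛_Γ(f))(z) = L₁₂(f)(z) + z·(d/dz)L₁₂(f)(z) − 2L₁₂(f)(z)/(1+z). -/
open Real MeasureTheory Set Filter

noncomputable section

/-- The angular kernel `K(θ) = 3 sin θ cos² θ`. -/
def Kker (θ : ℝ) : ℝ := 3 * Real.sin θ * Real.cos θ ^ 2

/-- `L₁₂(f)(z) = ∫_z^∞ ∫_0^{π/2} f(r,θ) K(θ)/r dθ dr`. -/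
def L12 (f : ℝ → ℝ → ℝ) (z : ℝ) : ℝ :=
  ∫ r in Ioi z, ∫ θ in Icc 0 (π / 2), f r θ * Kker θ / r

/-- The radial weight `w(z) = (1+z)²/z²`. -/
def wgt (z : ℝ) : ℝ := (1 + z) ^ 2 / z ^ 2

/-- `D_θ f = sin(2θ) ∂_θ f`. -/
def Dth (f : ℝ → ℝ → ℝ) (z θ : ℝ) : ℝ := Real.sin (2 * θ) * deriv (fun t => f z t) θ

/-- `D_z f = z ∂_z f`. -/
def Dzr (f : ℝ → ℝ → ℝ) (z θ : ℝ) : ℝ := z * deriv (fun s => f s θ) z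

/-- `Γ(θ) = (sin θ cos² θ)^{α/3}`. -/
def Gam (α θ : ℝ) : ℝ := (Real.sin θ * Real.cos θ ^ 2) ^ (α / 3)

/-- `c = ∫_0^{π/2} Γ(θ) K(θ) dθ`. -/
def cGam (α : ℝ) : ℝ := ∫ θ in Icc 0 (π / 2), Gam α θ * Kker θ

/-- `𝓛(f) = f + z ∂_z f - 2 f/(1+z)`. -/
def Lop (f : ℝ → ℝ → ℝ) (z θ : ℝ) : ℝ :=
  f z θ + z * deriv (fun s => f s θ) z - 2 * f z θ / (1 + z)

/-- `𝓛_Γ(f) = 𝓛(f) - (2zΓ(θ)/(c(1+z)²)) L₁₂(f)`. -/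
def LGam (α : ℝ) (f : ℝ → ℝ → ℝ) (z θ : ℝ) : ℝ :=
  Lop f z θ - 2 * z * Gam α θ / (cGam α * (1 + z) ^ 2) * L12 f z

/-- `ℙ(f)(z,θ) = f(z,θ) - (Γ(θ)/c)(2z²/(1+z)³) L₁₂(f)(0)`. -/
def Pproj (α : ℝ) (f : ℝ → ℝ → ℝ) (z θ : ℝ) : ℝ :=
  f z θ - Gam α θ / cGam α * (2 * z ^ 2 / (1 + z) ^ 3) * L12 f 0

/-- `𝓛_Γ^T(f) = 𝓛_Γ(f) - ℙ((3/(1+z)) D_θ f)`. -/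
def LGamT (α : ℝ) (f : ℝ → ℝ → ℝ) (z θ : ℝ) : ℝ :=
  LGam α f z θ - Pproj α (fun z2 θ2 => 3 / (1 + z2) * Dth f z2 θ2) z θ

/-- The `L²` inner product on `[0,∞) × [0,π/2]` with respect to `dz dθ`. -/
def ip (A B : ℝ → ℝ → ℝ) : ℝ :=
  ∫ z in Ioi (0 : ℝ), ∫ θ in Icc 0 (π / 2), A z θ * B z θ

/-- `f` is admissible: smooth on `[0,∞) × [0,π/2]` and vanishing for `z` outside a
compact subset of `(0,∞)`. -/
def Admissible (f : ℝ → ℝ → ℝ) : Prop :=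
  ContDiff ℝ (⊤ : ℕ∞) (Function.uncurry f) ∧
  ∃ a b : ℝ, 0 < a ∧ ∀ z θ : ℝ, z ∉ Icc a b → f z θ = 0


/-- The angular average `∫_0^{π/2} f(r,θ) K(θ) dθ`. -/
def angAvg (f : ℝ → ℝ → ℝ) (r : ℝ) : ℝ := ∫ θ in Icc 0 (π / 2), f r θ * Kker θ

lemma continuous_Kker : Continuous Kker := by
  unfold Kker
  fun_prop

lemma continuous_Gam {α : ℝ} (hα : 0 < α) : Continuous (Gam α) := by
  unfold Gam
  exact Continuous.rpow_const (by fun_prop) fun _ => Or.inr (by positivity)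

lemma cGam_pos {α : ℝ} (hα : 0 < α) : 0 < cGam α := by
  unfold cGam
  rw [integral_Icc_eq_integral_Ioc,
    ← intervalIntegral.integral_of_le (by positivity : (0 : ℝ) ≤ π / 2)]
  refine intervalIntegral.intervalIntegral_pos_of_pos_on
    (((continuous_Gam hα).mul continuous_Kker).intervalIntegrable _ _) ?_ (by positivity)
  intro θ hθ
  have hs : 0 < Real.sin θ := sin_pos_of_pos_of_lt_pi hθ.1 (by linarith [hθ.2, pi_pos])
  have hc : 0 < Real.cos θ := cos_pos_of_mem_Ioo ⟨by linarith [hθ.1, pi_pos], hθ.2⟩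
  unfold Gam Kker
  positivity

lemma hasDerivAt_left_of_contDiff {g : ℝ → ℝ → ℝ} (hg : ContDiff ℝ 1 (Function.uncurry g))
    (x θ : ℝ) :
    HasDerivAt (fun y => g y θ) (fderiv ℝ (Function.uncurry g) (x, θ) (1, 0)) x := by
  have h1 : HasFDerivAt (Function.uncurry g) (fderiv ℝ (Function.uncurry g) (x, θ)) (x, θ) :=
    (hg.differentiable one_ne_zero _).hasFDerivAt
  have h2 : HasDerivAt (fun y : ℝ => (y, θ)) ((1 : ℝ), (0 : ℝ)) x :=
    (hasDerivAt_id x).prodMk (hasDerivAt_const x θ)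
  exact h1.comp_hasDerivAt x h2

lemma continuous_deriv_left_of_contDiff {g : ℝ → ℝ → ℝ}
    (hg : ContDiff ℝ 1 (Function.uncurry g)) :
    Continuous (Function.uncurry fun x θ => deriv (fun y => g y θ) x) := by
  have h : (Function.uncurry fun x θ => deriv (fun y => g y θ) x) =
      fun p => fderiv ℝ (Function.uncurry g) p (1, 0) := by
    ext ⟨x, θ⟩
    exact (hasDerivAt_left_of_contDiff hg x θ).deriv
  rw [h]
  exact (hg.continuous_fderiv one_ne_zero).clm_apply continuous_const

lemma continuous_angAvg {g : ℝ → ℝ → ℝ} (hg : Continuous (Function.uncurry g)) :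
    Continuous (angAvg g) := by
  unfold angAvg
  refine continuous_parametric_integral_of_continuous
    (f := fun r θ => g r θ * Kker θ) ?_ isCompact_Icc
  exact hg.mul (continuous_Kker.comp continuous_snd)

lemma hasDerivAt_angAvg {f : ℝ → ℝ → ℝ} (hf : ContDiff ℝ 1 (Function.uncurry f)) (x : ℝ) :
    HasDerivAt (angAvg f) (angAvg (fun r θ => deriv (fun s => f s θ) r) x) x := by
  have hc := continuous_deriv_left_of_contDiff hf
  have hF : Continuous (Function.uncurry fun r θ => f r θ * Kker θ) :=
    hf.continuous.mul (continuous_Kker.comp continuous_snd)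
  have hF' : Continuous (Function.uncurry fun r θ => deriv (fun s => f s θ) r * Kker θ) :=
    hc.mul (continuous_Kker.comp continuous_snd)
  obtain ⟨M, hM⟩ := ((isCompact_closedBall x 1).prod
    (isCompact_Icc (a := (0 : ℝ)) (b := π / 2))).bddAbove_image hF'.norm.continuousOn
  refine (hasDerivAt_integral_of_dominated_loc_of_deriv_le
    (F := fun r θ => f r θ * Kker θ)
    (F' := fun r θ => deriv (fun s => f s θ) r * Kker θ) (bound := fun _ => M)
    (Metric.closedBall_mem_nhds x one_pos) ?_ ?_ ?_ ?_ ?_ ?_).2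
  · exact Eventually.of_forall fun r =>
      (hF.comp (Continuous.prodMk_right r)).aestronglyMeasurable
  · exact (hF.comp (Continuous.prodMk_right x)).integrableOn_Icc
  · exact (hF'.comp (Continuous.prodMk_right x)).aestronglyMeasurable
  · refine (ae_restrict_iff' measurableSet_Icc).2 (Eventually.of_forall fun θ hθ r hr => ?_)
    exact hM (mem_image_of_mem _ (mk_mem_prod hr hθ))
  · exact continuous_const.integrableOn_Icc
  · refine Eventually.of_forall fun θ r _ => ?_
    have h := hasDerivAt_left_of_contDiff hf r θ
    simpa only [h.deriv] using h.mul_const (Kker θ)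

lemma L12_eq (f : ℝ → ℝ → ℝ) (z : ℝ) : L12 f z = ∫ r in Ioi z, angAvg f r / r := by
  simp only [L12, angAvg, integral_div]

lemma angAvg_LGam {α : ℝ} (hα : 0 < α) {f : ℝ → ℝ → ℝ}
    (hf : ContDiff ℝ 1 (Function.uncurry f)) {r : ℝ} (hr : 0 < r) :
    angAvg (LGam α f) r = angAvg f r + r * angAvg (fun x θ => deriv (fun s => f s θ) x) r
      - 2 * angAvg f r / (1 + r) - 2 * r / (1 + r) ^ 2 * L12 f r := by
  have hc := cGam_pos hα
  have i1 : IntegrableOn (fun θ => f r θ * Kker θ) (Icc 0 (π / 2)) :=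
    ((hf.continuous.comp (Continuous.prodMk_right r)).mul continuous_Kker).integrableOn_Icc
  have i2 : IntegrableOn (fun θ => deriv (fun s => f s θ) r * Kker θ) (Icc 0 (π / 2)) :=
    (((continuous_deriv_left_of_contDiff hf).comp
      (Continuous.prodMk_right r)).mul continuous_Kker).integrableOn_Icc
  have i3 : IntegrableOn (fun θ => Gam α θ * Kker θ) (Icc 0 (π / 2)) :=
    ((continuous_Gam hα).mul continuous_Kker).integrableOn_Icc
  have hsplit : ∀ θ, LGam α f r θ * Kker θ =
      (1 - 2 / (1 + r)) * (f r θ * Kker θ) + r * (deriv (fun s => f s θ) r * Kker θ)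
        - 2 * r / (cGam α * (1 + r) ^ 2) * L12 f r * (Gam α θ * Kker θ) := by
    intro θ
    unfold LGam Lop
    ring
  have hG : ∫ θ in Icc 0 (π / 2), Gam α θ * Kker θ = cGam α := rfl
  have i12 : IntegrableOn (fun θ => (1 - 2 / (1 + r)) * (f r θ * Kker θ) +
      r * (deriv (fun s => f s θ) r * Kker θ)) (Icc 0 (π / 2)) :=
    (i1.const_mul _).add (i2.const_mul _)
  unfold angAvg
  simp only [hsplit]
  rw [integral_sub i12 (i3.const_mul _),
    integral_add (i1.const_mul _) (i2.const_mul _), integral_const_mul, integral_const_mul,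
    integral_const_mul, hG]
  field_simp
  ring

lemma angAvg_eq_zero {f : ℝ → ℝ → ℝ} {a b : ℝ}
    (h : ∀ z θ : ℝ, z ∉ Icc a b → f z θ = 0) {r : ℝ} (hr : r ∉ Icc a b) :
    angAvg f r = 0 := by
  simp [angAvg, h r _ hr]

lemma continuous_div_id_of_eq_zero {F : ℝ → ℝ} (hF : Continuous F) {a : ℝ} (ha : 0 < a)
    (h : ∀ r < a, F r = 0) : Continuous fun r => F r / r := by
  rw [continuous_iff_continuousAt]
  intro r
  rcases lt_or_ge r a with hr | hr
  · refine continuousAt_const.congr (f := fun _ => (0 : ℝ)) ?_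
    filter_upwards [Iio_mem_nhds hr] with s hs
    simp [h s hs]
  · exact hF.continuousAt.div continuousAt_id (ha.trans_le hr).ne'

lemma hasDerivAt_integral_Ioi {h : ℝ → ℝ} (hc : Continuous h) (hi : Integrable h) (z : ℝ) :
    HasDerivAt (fun x => ∫ r in Ioi x, h r) (-h z) z := by
  have heq : (fun x => ∫ r in Ioi x, h r) = fun x => (∫ r in Ioi 0, h r) - ∫ r in 0..x, h r := by
    ext x
    rw [← intervalIntegral.integral_Ioi_sub_Ioi' hi.integrableOn hi.integrableOn, sub_sub_cancel]
  rw [heq]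
  exact (hc.integral_hasStrictDerivAt 0 z).hasDerivAt.const_sub _

/-- The intertwining identity `L₁₂(𝓛_Γ(f)) = 𝓛(L₁₂(f))`: for admissible `f` and `z ≥ 0`,
`L₁₂(𝓛_Γ(f))(z) = L₁₂(f)(z) + z (d/dz) L₁₂(f)(z) − 2 L₁₂(f)(z)/(1+z)`. -/
theorem L12_intertwines_LGam (α : ℝ) (hα : α ∈ Ioc (0 : ℝ) 1)
    (f : ℝ → ℝ → ℝ) (hf : Admissible f) :
    ∀ z : ℝ, 0 ≤ z →
      L12 (LGam α f) z = L12 f z + z * deriv (L12 f) z - 2 * L12 f z / (1 + z) := by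
  intro z hz
  obtain ⟨hs, a, b, ha, hsupp⟩ := hf
  have hf1 : ContDiff ℝ 1 (Function.uncurry f) := hs.of_le (by exact_mod_cast le_top)
  set F := angAvg f with hFdef
  set F' := angAvg (fun r θ => deriv (fun s => f s θ) r) with hF'def
  have hFder : ∀ r, HasDerivAt F (F' r) r := hasDerivAt_angAvg hf1
  have hFc : Continuous F := continuous_angAvg hf1.continuous
  have hF'c : Continuous F' := continuous_angAvg (continuous_deriv_left_of_contDiff hf1)
  have hF0 : ∀ r ∉ Icc a b, F r = 0 := fun r hr => angAvg_eq_zero hsupp hr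
  have hF'0 : ∀ r, b < r → F' r = 0 := by
    intro r hr
    refine (hFder r).unique ((hasDerivAt_const r (0 : ℝ)).congr_of_eventuallyEq ?_)
    filter_upwards [Ioi_mem_nhds hr] with s hs
    exact hF0 s fun h => (h.2.trans_lt hs).false
  have hhc : Continuous fun r => F r / r :=
    continuous_div_id_of_eq_zero hFc ha fun r hr => hF0 r fun h => (h.1.trans_lt hr).false
  have hhi : Integrable fun r => F r / r :=
    hhc.integrable_of_hasCompactSupport <|
      HasCompactSupport.intro (isCompact_Icc (a := a) (b := b)) fun r hr => by simp [hF0 r hr]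
  have hG : L12 f = fun z => ∫ r in Ioi z, F r / r := funext (L12_eq f)
  have hGder : ∀ r, HasDerivAt (L12 f) (-(F r / r)) r := by
    rw [hG]
    exact hasDerivAt_integral_Ioi hhc hhi
  have hGc : Continuous (L12 f) := continuous_iff_continuousAt.2 fun r => (hGder r).continuousAt
  have hG0 : ∀ r, b < r → L12 f r = 0 := by
    intro r hr
    rw [L12_eq]
    refine setIntegral_eq_zero_of_forall_eq_zero fun s hs => ?_
    have : F s = 0 := hF0 s fun h => (h.2.trans_lt (hr.trans hs)).false
    rw [← hFdef, this, zero_div]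
  have hzF : z * (F z / z) = F z := by
    rcases hz.eq_or_lt with rfl | hz'
    · rw [zero_mul, hF0 0 fun h => (ha.trans_le h.1).false]
    · field_simp
  let Φ' : ℝ → ℝ := fun r =>
    F r / r + F' r - 2 * (F r / r) / (1 + r) - 2 / (1 + r) ^ 2 * L12 f r
  have hΦ : ∀ r ∈ Ici z, HasDerivAt (fun r => -L12 f r + F r + 2 * L12 f r / (1 + r)) (Φ' r) r := by
    intro r hr
    have hr1 : 1 + r ≠ 0 := (add_pos_of_pos_of_nonneg one_pos (hz.trans hr)).ne'
    have hd := ((hGder r).neg.add (hFder r)).add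
      (((hGder r).const_mul 2).div ((hasDerivAt_id r).const_add 1) hr1)
    refine hd.congr_deriv ?_
    simp only [Φ', id]
    field_simp
    ring
  have hint : IntegrableOn Φ' (Ioi z) := by
    have hcont : ContinuousOn Φ' (Icc z b) := by
      have h1 : ∀ r ∈ Icc z b, 1 + r ≠ 0 := fun r hr => by
        have := hz.trans hr.1
        positivity
      have h2 : ∀ r ∈ Icc z b, (1 + r) ^ 2 ≠ 0 := fun r hr => pow_ne_zero 2 (h1 r hr)
      have h3 : ContinuousOn (fun r : ℝ => 1 + r) (Icc z b) := by fun_prop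
      exact (((hhc.add hF'c).continuousOn).sub ((hhc.const_mul 2).continuousOn.div h3 h1)).sub
        ((continuousOn_const.div (h3.pow 2) h2).mul hGc.continuousOn)
    refine hcont.integrableOn_Icc.of_forall_sdiff_eq_zero measurableSet_Ioi fun r hr => ?_
    have hbr : b < r := by
      by_contra! h
      exact hr.2 ⟨le_of_lt hr.1, h⟩
    have : F r = 0 := hF0 r fun h => (h.2.trans_lt hbr).false
    simp [Φ', this, hF'0 r hbr, hG0 r hbr]
  have hlim : Tendsto (fun r => -L12 f r + F r + 2 * L12 f r / (1 + r)) atTop (nhds 0) := by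
    refine tendsto_const_nhds.congr' ?_
    filter_upwards [Ioi_mem_atTop b] with r hr
    have : F r = 0 := hF0 r fun h => (h.2.trans_lt hr).false
    simp [this, hG0 r hr]
  have hLHS : L12 (LGam α f) z = ∫ r in Ioi z, Φ' r := by
    rw [L12_eq]
    refine setIntegral_congr_fun measurableSet_Ioi fun r hr => ?_
    have hr0 : 0 < r := hz.trans_lt hr
    simp only [Φ', angAvg_LGam hα.1 hf1 hr0, ← hFdef, ← hF'def]
    field_simp
  rw [hLHS, integral_Ioi_of_hasDerivAt_of_tendsto' hΦ hint hlim, (hGder z).deriv, mul_neg, hzF]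
  ring
end
end

section
/- Weighted Hardy inequality for L₁₂: if f : [0,∞)×[0,π/2] → ℝ is measurable with f·w ∈ L² and L₁₂(f)·w ∈ L² (norms with respect to the measure dz dθ), then ‖L₁₂(f)·w‖_{L²} ≤ 4‖f·w‖_{L²}. -/
open Real MeasureTheory Set Filter

noncomputable section

/-- The antiderivative `z + 4 log z - 6/z - 2/z² - 1/(3z³)` of the squared weight `w²`. -/
def wgtSqPrim (z : ℝ) : ℝ :=
  z + 4 * Real.log z - 6 * z⁻¹ - 2 * (z ^ 2)⁻¹ - 1 / 3 * (z ^ 3)⁻¹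

lemma wgt_pos {z : ℝ} (hz : 0 < z) : 0 < wgt z := by
  unfold wgt; positivity

lemma one_le_wgt {z : ℝ} (hz : 0 < z) : 1 ≤ wgt z := by
  rw [wgt, le_div_iff₀ (by positivity)]
  nlinarith

lemma hasDerivAt_wgtSqPrim {z : ℝ} (hz : 0 < z) :
    HasDerivAt wgtSqPrim (wgt z ^ 2) z := by
  have hz0 : z ≠ 0 := hz.ne'
  have h := ((((hasDerivAt_id z).add ((Real.hasDerivAt_log hz0).const_mul 4)).sub
    ((hasDerivAt_inv hz0).const_mul 6)).sub
    (((hasDerivAt_pow 2 z).inv (pow_ne_zero 2 hz0)).const_mul 2)).sub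
    (((hasDerivAt_pow 3 z).inv (pow_ne_zero 3 hz0)).const_mul (1 / 3))
  convert! h using 1
  simp only [wgt]
  field_simp
  ring

lemma contDiffOn_wgtSqPrim : ContDiffOn ℝ 1 wgtSqPrim (Ioi 0) := by
  have h0 : ∀ z ∈ Ioi (0 : ℝ), z ≠ 0 := fun z hz => ne_of_gt hz
  unfold wgtSqPrim
  refine ((((contDiffOn_id.add (contDiffOn_const.mul (contDiffOn_id.log h0))).sub
    (contDiffOn_const.mul (contDiffOn_id.inv h0))).sub
    (contDiffOn_const.mul ((contDiffOn_id.pow 2).inv fun z hz => pow_ne_zero 2 (h0 z hz)))).sub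
    (contDiffOn_const.mul ((contDiffOn_id.pow 3).inv fun z hz => pow_ne_zero 3 (h0 z hz))))

lemma abs_wgtSqPrim_le {z : ℝ} (hz : 0 < z) :
    |wgtSqPrim z| ≤ 3 / 2 * (z * wgt z ^ 2) := by
  have hz0 : z ≠ 0 := hz.ne'
  have hexp : z * wgt z ^ 2 = z + 4 + 6 * z⁻¹ + 4 * (z ^ 2)⁻¹ + (z ^ 3)⁻¹ := by
    simp only [wgt]; field_simp; ring
  have h1 : 0 < z⁻¹ := by positivity
  have h2 : 0 < (z ^ 2)⁻¹ := by positivity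
  have h3 : 0 < (z ^ 3)⁻¹ := by positivity
  have hup : Real.log z ≤ z / 8 + 3 / 2 := by
    have ha : Real.log (z / 8) ≤ z / 8 - 1 := Real.log_le_sub_one_of_pos (by positivity)
    rw [Real.log_div hz0 (by norm_num), show (8 : ℝ) = 2 ^ 3 by norm_num, Real.log_pow] at ha
    have := Real.log_two_lt_d9
    push_cast at ha
    linarith
  have hlow : -Real.log z ≤ z⁻¹ / 2 := by
    have ha : Real.log (z⁻¹ / 2) ≤ z⁻¹ / 2 - 1 := Real.log_le_sub_one_of_pos (by positivity)
    rw [Real.log_div h1.ne' (by norm_num), Real.log_inv] at ha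
    have := Real.log_two_lt_d9
    linarith
  rw [hexp, wgtSqPrim, abs_le]
  constructor <;> linarith

/-- Integration by parts for the square of a primitive of an integrable function. -/
lemma integral_sq_mul_wgt_sq {L h : ℝ → ℝ} {a b : ℝ} (ha : 0 < a) (hab : a ≤ b)
    (hh : IntervalIntegrable h volume a b)
    (hL : ∀ z ∈ Icc a b, L z = L a - ∫ r in a..z, h r) :
    ∫ z in a..b, (L z * wgt z) ^ 2 = L b ^ 2 * wgtSqPrim b - L a ^ 2 * wgtSqPrim a
      + ∫ z in a..b, 2 * L z * h z * wgtSqPrim z := by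
  set P : ℝ → ℝ := fun z => L a - ∫ r in a..z, h r with hP
  have hPac : AbsolutelyContinuousOnInterval P a b :=
    (contDiff_const (c := L a)).contDiffOn.absolutelyContinuousOnInterval.sub
      (hh.absolutelyContinuousOnInterval_intervalIntegral left_mem_uIcc)
  have hpos : uIcc a b ⊆ Ioi 0 := by
    rw [uIcc_of_le hab]; exact fun z hz => ha.trans_le hz.1
  have hVac : AbsolutelyContinuousOnInterval wgtSqPrim a b :=
    (contDiffOn_wgtSqPrim.mono hpos).absolutelyContinuousOnInterval
  have key := (hPac.mul hPac).integral_mul_deriv_eq_deriv_mul hVac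
  have hPL : ∀ z ∈ uIcc a b, P z = L z := fun z hz => (hL z (uIcc_of_le hab ▸ hz)).symm
  have e1 : ∫ z in a..b, (P * P) z * deriv wgtSqPrim z = ∫ z in a..b, (L z * wgt z) ^ 2 := by
    refine intervalIntegral.integral_congr fun z hz => ?_
    simp only [Pi.mul_apply, hPL z hz, (hasDerivAt_wgtSqPrim (hpos hz)).deriv]
    ring
  have e2 : ∫ z in a..b, deriv (P * P) z * wgtSqPrim z
      = ∫ z in a..b, -(2 * L z * h z * wgtSqPrim z) := by
    refine intervalIntegral.integral_congr_ae ?_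
    filter_upwards [hh.ae_hasDerivAt_integral] with z hz hzm
    have hzm' := uIoc_subset_uIcc hzm
    have hd : HasDerivAt P (-h z) z := (hz hzm' a left_mem_uIcc).const_sub (L a)
    rw [(hd.mul hd).deriv, hPL z hzm']
    ring
  rw [e1, e2, intervalIntegral.integral_neg] at key
  simp only [Pi.mul_apply, hPL _ left_mem_uIcc, hPL _ right_mem_uIcc] at key
  rw [key]
  ring

lemma frequently_atTop_mul_lt {φ : ℝ → ℝ} (hφ : IntegrableOn φ (Ioi 0)) {ε : ℝ} (hε : 0 < ε) :
    ∃ᶠ z in atTop, z * φ z < ε := by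
  intro hev
  obtain ⟨B, hB⟩ := eventually_atTop.1 (hev.and (eventually_gt_atTop 0))
  refine not_integrableOn_Ioi_inv (a := max B 0) ?_
  have hint : IntegrableOn (fun z => ε⁻¹ * φ z) (Ioi (max B 0)) :=
    (hφ.mono_set (Ioi_subset_Ioi (le_max_right _ _))).const_mul _
  refine Integrable.mono' hint measurable_inv.aestronglyMeasurable ?_
  filter_upwards [ae_restrict_mem measurableSet_Ioi] with z hz
  obtain ⟨h1, h2⟩ := hB z ((le_max_left _ _).trans (le_of_lt hz))
  rw [Real.norm_of_nonneg (by positivity), inv_mul_eq_div, inv_eq_one_div,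
    div_le_div_iff₀ h2 hε]
  linarith

lemma frequently_nhdsGT_zero_mul_lt {φ : ℝ → ℝ} (hφ : IntegrableOn φ (Ioi 0)) {ε : ℝ}
    (hε : 0 < ε) : ∃ᶠ z in nhdsWithin (0 : ℝ) (Ioi 0), z * φ z < ε := by
  intro hev
  obtain ⟨δ, hδ, hB⟩ := (mem_nhdsGT_iff_exists_Ioc_subset).1 hev
  have hδ0 : (0 : ℝ) < δ := hδ
  have hn : ¬ IntervalIntegrable (fun x : ℝ => x⁻¹) volume 0 δ := by
    simp [hδ0.ne]
  refine hn ((intervalIntegrable_iff_integrableOn_Ioc_of_le hδ0.le).2 ?_)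
  have hint : IntegrableOn (fun z => ε⁻¹ * φ z) (Ioc 0 δ) :=
    (hφ.mono_set Ioc_subset_Ioi_self).const_mul _
  refine Integrable.mono' hint measurable_inv.aestronglyMeasurable ?_
  filter_upwards [ae_restrict_mem measurableSet_Ioc] with z hz
  have h1 : ¬ z * φ z < ε := hB hz
  have h2 : 0 < z := hz.1
  rw [Real.norm_of_nonneg (by positivity), inv_mul_eq_div, inv_eq_one_div,
    div_le_div_iff₀ h2 hε]
  linarith

lemma integrableOn_div_Ioi {g : ℝ → ℝ} (hg : Measurable g)
    (hgw : IntegrableOn (fun z => (g z * wgt z) ^ 2) (Ioi 0)) {a : ℝ} (ha : 0 < a) :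
    IntegrableOn (fun r => g r / r) (Ioi a) := by
  have h2 : IntegrableOn (fun r : ℝ => r ^ (-2 : ℝ)) (Ioi a) :=
    integrableOn_Ioi_rpow_of_lt (by norm_num) ha
  refine Integrable.mono' ((hgw.mono_set (Ioi_subset_Ioi ha.le)).add h2)
    (hg.div measurable_id).aestronglyMeasurable ?_
  filter_upwards [ae_restrict_mem measurableSet_Ioi] with r hr
  have hr0 : 0 < r := ha.trans hr
  have hw := one_le_wgt hr0
  have e : r ^ (-2 : ℝ) = r⁻¹ ^ 2 := by
    rw [Real.rpow_neg hr0.le, inv_pow]; norm_cast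
  have hgg : g r ^ 2 ≤ (g r * wgt r) ^ 2 := by
    rw [mul_pow]
    exact le_mul_of_one_le_right (sq_nonneg _) (one_le_pow₀ hw)
  rw [Pi.add_apply, e, div_eq_mul_inv, Real.norm_eq_abs, abs_mul, ← sq_abs r⁻¹]
  nlinarith [sq_nonneg (|g r| - |r⁻¹|), sq_abs (g r), sq_nonneg |g r|, sq_nonneg |r⁻¹|]

/-- One-dimensional Hardy inequality with the weight `w`. -/
lemma integral_tail_mul_wgt_sq_le {g L : ℝ → ℝ} (hg : Measurable g)
    (hL : ∀ z, L z = ∫ r in Ioi z, g r / r)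
    (hgw : IntegrableOn (fun z => (g z * wgt z) ^ 2) (Ioi 0))
    (hLw : IntegrableOn (fun z => (L z * wgt z) ^ 2) (Ioi 0)) :
    ∫ z in Ioi (0 : ℝ), (L z * wgt z) ^ 2 ≤ 9 * ∫ z in Ioi (0 : ℝ), (g z * wgt z) ^ 2 := by
  set φ : ℝ → ℝ := fun z => (L z * wgt z) ^ 2 with hφ
  set ψ : ℝ → ℝ := fun z => (g z * wgt z) ^ 2 with hψ
  have hend : ∀ z, 0 < z → |L z ^ 2 * wgtSqPrim z| ≤ 3 / 2 * (z * φ z) := fun z hz => by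
    rw [abs_mul, abs_of_nonneg (sq_nonneg _)]
    calc L z ^ 2 * |wgtSqPrim z| ≤ L z ^ 2 * (3 / 2 * (z * wgt z ^ 2)) := by
          gcongr; exact abs_wgtSqPrim_le hz
      _ = _ := by simp only [hφ]; ring
  have hfin : ∀ a b ε : ℝ, 0 < a → a ≤ b → a * φ a < ε → b * φ b < ε →
      ∫ z in Ioc a b, φ z ≤ 6 * ε + 9 * ∫ z in Ioi (0 : ℝ), ψ z := fun a b ε ha hab hεa hεb => by
    have hsub : Ioc a b ⊆ Ioi 0 := fun z hz => ha.trans hz.1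
    have hdiv := integrableOn_div_Ioi hg hgw ha
    have hh : IntervalIntegrable (fun r => g r / r) volume a b :=
      (intervalIntegrable_iff_integrableOn_Ioc_of_le hab).2 (hdiv.mono_set Ioc_subset_Ioi_self)
    have hLab : ∀ z ∈ Icc a b, L z = L a - ∫ r in a..z, g r / r := fun z hz => by
      rw [hL, hL, intervalIntegral.integral_of_le hz.1, ← Ioc_union_Ioi_eq_Ioi hz.1,
        setIntegral_union (Ioc_disjoint_Ioi le_rfl) measurableSet_Ioi
          (hdiv.mono_set Ioc_subset_Ioi_self) (hdiv.mono_set (Ioi_subset_Ioi hz.1))]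
      ring
    have hid := integral_sq_mul_wgt_sq ha hab hh hLab
    have hφi : IntervalIntegrable φ volume a b :=
      (intervalIntegrable_iff_integrableOn_Ioc_of_le hab).2 (hLw.mono_set hsub)
    have hψi : IntervalIntegrable ψ volume a b :=
      (intervalIntegrable_iff_integrableOn_Ioc_of_le hab).2 (hgw.mono_set hsub)
    have hpos : uIcc a b ⊆ Ioi 0 := by
      rw [uIcc_of_le hab]; exact fun z hz => ha.trans_le hz.1
    have hLc : ContinuousOn L (uIcc a b) :=
      (continuousOn_const.sub (hh.absolutelyContinuousOnInterval_intervalIntegral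
        left_mem_uIcc).continuousOn).congr fun z hz => hLab z (uIcc_of_le hab ▸ hz)
    have hcross : IntervalIntegrable (fun z => 2 * L z * (g z / z) * wgtSqPrim z) volume a b :=
      (hh.continuousOn_mul (continuousOn_const.mul hLc)).mul_continuousOn
        (contDiffOn_wgtSqPrim.continuousOn.mono hpos)
    have hyoung : ∫ z in a..b, 2 * L z * (g z / z) * wgtSqPrim z
        ≤ ∫ z in a..b, (1 / 2 * φ z + 9 / 2 * ψ z) := by
      refine intervalIntegral.integral_mono_on hab hcross
        ((hφi.const_mul _).add (hψi.const_mul _)) fun z hz => ?_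
      have hz0 : 0 < z := ha.trans_le hz.1
      have hV : |wgtSqPrim z / z| ≤ 3 / 2 * wgt z ^ 2 := by
        rw [abs_div, abs_of_pos hz0, div_le_iff₀ hz0]
        linarith [abs_wgtSqPrim_le hz0]
      calc 2 * L z * (g z / z) * wgtSqPrim z = 2 * (L z * g z) * (wgtSqPrim z / z) := by ring
        _ ≤ |2 * (L z * g z) * (wgtSqPrim z / z)| := le_abs_self _
        _ = 2 * (|L z| * |g z|) * |wgtSqPrim z / z| := by
          rw [abs_mul, abs_mul, abs_mul, abs_two]
        _ ≤ 2 * (|L z| * |g z|) * (3 / 2 * wgt z ^ 2) := by gcongr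
        _ ≤ (1 / 2 * |L z| ^ 2 + 9 / 2 * |g z| ^ 2) * wgt z ^ 2 := by
          nlinarith [mul_nonneg (sq_nonneg (|L z| - 3 * |g z|)) (sq_nonneg (wgt z))]
        _ = _ := by simp only [hφ, hψ, sq_abs]; ring
    rw [intervalIntegral.integral_add (hφi.const_mul _) (hψi.const_mul _),
      intervalIntegral.integral_const_mul, intervalIntegral.integral_const_mul] at hyoung
    have hψle : ∫ z in a..b, ψ z ≤ ∫ z in Ioi (0 : ℝ), ψ z := by
      rw [intervalIntegral.integral_of_le hab]
      exact setIntegral_mono_set hgw (ae_of_all _ fun z => sq_nonneg _) hsub.eventuallyLE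
    have hb := (le_abs_self _).trans (hend b (ha.trans_le hab))
    have ha' := (neg_abs_le _).trans' (neg_le_neg (hend a ha))
    rw [← intervalIntegral.integral_of_le hab]
    change ∫ z in a..b, φ z = _ at hid
    linarith
  refine le_of_forall_pos_le_add fun δ hδ => ?_
  obtain ⟨a, ha, haφ⟩ := exists_seq_forall_of_frequently
    (frequently_nhdsGT_zero_mul_lt hLw (ε := δ / 6) (by positivity))
  obtain ⟨b, hb, hbφ⟩ := exists_seq_forall_of_frequently
    (frequently_atTop_mul_lt hLw (ε := δ / 6) (by positivity))
  have hcov : AECover (volume.restrict (Ioi (0 : ℝ))) atTop fun n => Ioc (a n) (b n) := by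
    refine ⟨?_, fun n => measurableSet_Ioc⟩
    filter_upwards [ae_restrict_mem measurableSet_Ioi] with z hz
    filter_upwards [(tendsto_nhds_of_tendsto_nhdsWithin ha).eventually_lt_const hz,
      hb.eventually_ge_atTop z] with n h1 h2 using ⟨h1, h2⟩
  refine le_of_tendsto (hcov.integral_tendsto_of_countably_generated hLw) ?_
  filter_upwards [ha.eventually self_mem_nhdsWithin,
    (tendsto_nhds_of_tendsto_nhdsWithin ha).eventually_lt_const one_pos,
    hb.eventually_ge_atTop 1] with n h0 h1 h2
  have h0' : 0 < a n := h0
  have hsub : Ioc (a n) (b n) ⊆ Ioi 0 := fun z hz => h0'.trans hz.1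
  rw [Measure.restrict_restrict measurableSet_Ioc, inter_eq_left.2 hsub]
  have := hfin (a n) (b n) (δ / 6) h0' (h1.le.trans h2) (haφ n) (hbφ n)
  linarith

lemma sq_integral_mul_le {α : Type*} [MeasurableSpace α] {μ : Measure α} {u k : α → ℝ}
    (hu : MemLp u 2 μ) (hk : MemLp k 2 μ) (hpos : 0 < ∫ x, k x ^ 2 ∂μ) :
    (∫ x, u x * k x ∂μ) ^ 2 ≤ (∫ x, k x ^ 2 ∂μ) * ∫ x, u x ^ 2 ∂μ := by
  set C := ∫ x, k x ^ 2 ∂μ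
  set B := ∫ x, u x * k x ∂μ
  have huk : Integrable (fun x => u x * k x) μ := hu.integrable_mul hk
  have h0 : 0 ≤ ∫ x, (C * u x - B * k x) ^ 2 ∂μ := integral_nonneg fun x => sq_nonneg _
  have e : ∫ x, (C * u x - B * k x) ^ 2 ∂μ
      = C ^ 2 * ∫ x, u x ^ 2 ∂μ - 2 * C * B * B + B ^ 2 * C := by
    have : ∀ x, (C * u x - B * k x) ^ 2
        = C ^ 2 * u x ^ 2 - 2 * C * B * (u x * k x) + B ^ 2 * k x ^ 2 := fun x => by ring
    have hi₁ : Integrable (fun x => C ^ 2 * u x ^ 2) μ := hu.integrable_sq.const_mul _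
    have hi₂ : Integrable (fun x => 2 * C * B * (u x * k x)) μ := huk.const_mul _
    have hi₁₂ : Integrable (fun x => C ^ 2 * u x ^ 2 - 2 * C * B * (u x * k x)) μ := hi₁.sub hi₂
    simp only [this]
    rw [integral_add hi₁₂ (hk.integrable_sq.const_mul _), integral_sub hi₁ hi₂, integral_const_mul, integral_const_mul, integral_const_mul]
  rw [e] at h0
  have : 0 ≤ C * (C * ∫ x, u x ^ 2 ∂μ - B ^ 2) := by linarith
  linarith [nonneg_of_mul_nonneg_right this hpos]

lemma integral_Kker_sq : ∫ θ in Icc 0 (π / 2), Kker θ ^ 2 = 9 * π / 32 := by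
  rw [integral_Icc_eq_integral_Ioc, ← intervalIntegral.integral_of_le (by positivity)]
  have hd : ∀ x ∈ uIcc 0 (π / 2), HasDerivAt (fun x => sin x ^ 3 * cos x ^ 3 * (3 / 2))
      (Kker x ^ 2 - 9 / 2 * (sin x ^ 2 * cos x ^ 2)) x := fun x _ => by
    convert! (((Real.hasDerivAt_sin x).pow 3).mul
      ((Real.hasDerivAt_cos x).pow 3)).mul_const (3 / 2) using 1
    simp only [Kker, Pi.pow_apply]
    have hs : sin x ^ 4 = sin x ^ 2 * (1 - cos x ^ 2) := by rw [← Real.sin_sq]; ring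
    linear_combination (9 / 2 * cos x ^ 2) * hs
  have hK2 : Continuous fun x => Kker x ^ 2 := continuous_Kker.pow 2
  have hsc : Continuous fun x => 9 / 2 * (sin x ^ 2 * cos x ^ 2) := by fun_prop
  have h := intervalIntegral.integral_eq_sub_of_hasDerivAt hd
    ((hK2.sub hsc).intervalIntegrable _ _)
  rw [intervalIntegral.integral_sub (hK2.intervalIntegrable _ _) (hsc.intervalIntegrable _ _),
    intervalIntegral.integral_const_mul, integral_sin_sq_mul_cos_sq] at h
  have h4 : sin (4 * (π / 2)) = 0 := by rw [show 4 * (π / 2) = 2 * π by ring, Real.sin_two_pi]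
  rw [h4] at h
  norm_num at h
  linarith

/-- Weighted Hardy inequality for `L₁₂`: if `f·w ∈ L²` and `L₁₂(f)·w ∈ L²` on
`[0,∞)×[0,π/2]` (measure `dz dθ`), then `‖L₁₂(f)·w‖_{L²} ≤ 4 ‖f·w‖_{L²}`. -/
theorem L12_weighted_hardy (f : ℝ → ℝ → ℝ)
    (hmeas : Measurable (Function.uncurry f))
    (hfw : IntegrableOn (fun p : ℝ × ℝ => (f p.1 p.2 * wgt p.1) ^ 2)
      (Ioi 0 ×ˢ Icc 0 (π / 2)))
    (hLw : IntegrableOn (fun p : ℝ × ℝ => (L12 f p.1 * wgt p.1) ^ 2)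
      (Ioi 0 ×ˢ Icc 0 (π / 2))) :
    Real.sqrt (∫ z in Ioi (0 : ℝ), ∫ θ in Icc 0 (π / 2), (L12 f z * wgt z) ^ 2) ≤
      4 * Real.sqrt (∫ z in Ioi (0 : ℝ), ∫ θ in Icc 0 (π / 2), (f z θ * wgt z) ^ 2) := by
  set g : ℝ → ℝ := fun r => ∫ θ in Icc 0 (π / 2), f r θ * Kker θ with hgdef
  have hg : Measurable g := by
    have : StronglyMeasurable (Function.uncurry fun r θ => f r θ * Kker θ) :=
      (hmeas.mul (continuous_Kker.measurable.comp measurable_snd)).stronglyMeasurable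
    exact this.integral_prod_right.measurable
  have hL : ∀ z, L12 f z = ∫ r in Ioi z, g r / r := fun z => by
    simp only [L12, hgdef, integral_div]
  rw [IntegrableOn, Measure.volume_eq_prod, ← Measure.prod_restrict] at hfw hLw
  have hA := hfw.integral_prod_left
  have hconst : ∀ c : ℝ, ∫ _ in Icc 0 (π / 2), c = π / 2 * c := fun c => by
    simp [Real.pi_nonneg, div_nonneg]
  have hLi : IntegrableOn (fun z => (L12 f z * wgt z) ^ 2) (Ioi 0) := by
    have := hLw.integral_prod_left
    simp only [hconst] at this
    exact (integrable_const_mul_iff (IsUnit.mk0 _ (by positivity)) _).1 this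
  have hCS : ∀ᵐ r ∂volume.restrict (Ioi (0 : ℝ)), (g r * wgt r) ^ 2
      ≤ 9 * π / 32 * ∫ θ in Icc 0 (π / 2), (f r θ * wgt r) ^ 2 := by
    filter_upwards [hfw.prod_right_ae] with r hr
    have hu : MemLp (fun θ => f r θ * wgt r) 2 (volume.restrict (Icc 0 (π / 2))) :=
      (memLp_two_iff_integrable_sq
        ((hmeas.of_uncurry_left.mul_const _).aestronglyMeasurable)).2 hr
    have hk : MemLp Kker 2 (volume.restrict (Icc 0 (π / 2))) :=
      (memLp_two_iff_integrable_sq continuous_Kker.aestronglyMeasurable).2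
        (continuous_Kker.pow 2).continuousOn.integrableOn_Icc
    have h := sq_integral_mul_le hu hk (by rw [integral_Kker_sq]; positivity)
    rw [integral_Kker_sq] at h
    convert! h using 2
    rw [← integral_mul_const]
    exact integral_congr_ae (ae_of_all _ fun θ => by ring)
  have hgw : IntegrableOn (fun z => (g z * wgt z) ^ 2) (Ioi 0) := by
    refine Integrable.mono' (hA.const_mul (9 * π / 32)) ?_ ?_
    · have hw : Measurable wgt := by unfold wgt; fun_prop
      exact ((hg.mul hw).pow_const 2).aestronglyMeasurable
    · filter_upwards [hCS] with r hr
      rwa [Real.norm_of_nonneg (sq_nonneg _)]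
  have hH := integral_tail_mul_wgt_sq_le hg hL hgw hLi
  have hM := integral_mono_ae hgw (hA.const_mul (9 * π / 32)) hCS
  rw [integral_const_mul] at hM
  have hY : 0 ≤ ∫ z in Ioi (0 : ℝ), ∫ θ in Icc 0 (π / 2), (f z θ * wgt z) ^ 2 :=
    integral_nonneg fun z => integral_nonneg fun θ => sq_nonneg _
  simp only [hconst]
  rw [integral_const_mul]
  set X := ∫ z in Ioi (0 : ℝ), (L12 f z * wgt z) ^ 2
  set Y := ∫ z in Ioi (0 : ℝ), ∫ θ in Icc 0 (π / 2), (f z θ * wgt z) ^ 2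
  have hXY : π / 2 * X ≤ 4 ^ 2 * Y := by
    have hpi : π ^ 2 ≤ 10 := by nlinarith [Real.pi_lt_d2, Real.pi_pos]
    calc π / 2 * X ≤ π / 2 * (9 * (9 * π / 32 * Y)) := by
          gcongr; linarith
      _ = 81 / 64 * π ^ 2 * Y := by ring
      _ ≤ 4 ^ 2 * Y := by gcongr; linarith
  calc √(π / 2 * X) ≤ √(4 ^ 2 * Y) := Real.sqrt_le_sqrt hXY
    _ = 4 * √Y := by rw [Real.sqrt_mul (by norm_num), Real.sqrt_sq (by norm_num)]
end
end

section
/- For every β ∈ [0,1], setting Γ_β(θ) = (sin θ cos²θ)^β on [0,π/2], K(θ) = 3 sin θ cos²θ, and c_β = ∫₀^{π/2} Γ_β(θ)K(θ) dθ, one has the L² bound ‖Γ_β/c_β − K‖_{L²([0,π/2])} ≤ 7/10, i.e. ∫₀^{π/2} (Γ_β(θ)/c_β − K(θ))² dθ ≤ (7/10)². -/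
open Real MeasureTheory Set

noncomputable section

/-- `Γ_β(θ) = (sin θ cos² θ)^β`. -/
def Gamb (β θ : ℝ) : ℝ := (Real.sin θ * Real.cos θ ^ 2) ^ β

/-- `c_β = ∫_0^{π/2} Γ_β(θ) K(θ) dθ`. -/
def cGamb (β : ℝ) : ℝ := ∫ θ in Icc 0 (π / 2), Gamb β θ * Kker θ

/-- The profile `sin θ cos² θ`, whose powers are integrated throughout. -/
def angProfile (θ : ℝ) : ℝ := Real.sin θ * Real.cos θ ^ 2

/-- The moment `∫_0^{π/2} (sin θ cos² θ)^s dθ`. -/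
def angMoment (s : ℝ) : ℝ := ∫ θ in (0 : ℝ)..(π / 2), angProfile θ ^ s

lemma angProfile_nonneg {θ : ℝ} (h : θ ∈ Icc 0 (π / 2)) : 0 ≤ angProfile θ :=
  mul_nonneg (Real.sin_nonneg_of_nonneg_of_le_pi h.1 (by linarith [h.2, Real.pi_pos]))
    (sq_nonneg _)

lemma continuous_angProfile : Continuous angProfile := by
  unfold angProfile
  fun_prop

lemma continuous_angProfile_rpow {s : ℝ} (hs : 0 ≤ s) :
    Continuous fun θ => angProfile θ ^ s :=
  continuous_angProfile.rpow_const fun _ => Or.inr hs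

lemma angMoment_zero : angMoment 0 = π / 2 := by
  simp [angMoment]

lemma angMoment_one : angMoment 1 = 1 / 3 := by
  have h : ∀ θ ∈ uIcc (0 : ℝ) (π / 2),
      HasDerivAt (fun x => -(Real.cos x ^ 3) / 3) (angProfile θ) θ := fun θ _ => by
    refine (((Real.hasDerivAt_cos θ).pow 3).neg.div_const 3).congr_deriv ?_
    simp only [angProfile]
    push_cast
    ring
  simp only [angMoment, Real.rpow_one]
  rw [intervalIntegral.integral_eq_sub_of_hasDerivAt h
    (continuous_angProfile.intervalIntegrable _ _)]
  norm_num

lemma integral_angProfile_sq : ∫ θ in (0 : ℝ)..(π / 2), angProfile θ ^ 2 = π / 32 := by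
  have h : ∀ θ ∈ uIcc (0 : ℝ) (π / 2),
      HasDerivAt (fun x => x / 16 + Real.sin x * Real.cos x / 16
        + Real.sin x * Real.cos x ^ 3 / 24 - Real.sin x * Real.cos x ^ 5 / 6)
        (angProfile θ ^ 2) θ := fun θ _ => by
    have hs := Real.hasDerivAt_sin θ
    have hc := Real.hasDerivAt_cos θ
    refine (((((hasDerivAt_id θ).div_const 16).add ((hs.mul hc).div_const 16)).add
      ((hs.mul (hc.pow 3)).div_const 24)).sub ((hs.mul (hc.pow 5)).div_const 6)).congr_deriv ?_
    have e := Real.sin_sq θ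
    simp only [angProfile, Pi.pow_apply]
    push_cast
    linear_combination -(Real.cos θ ^ 4 / 6 + Real.cos θ ^ 2 / 8 + 1 / 16) * e
  rw [intervalIntegral.integral_eq_sub_of_hasDerivAt h
    ((continuous_angProfile.pow 2).intervalIntegrable _ _)]
  norm_num
  ring

lemma angMoment_pos {s : ℝ} (hs : 0 ≤ s) : 0 < angMoment s := by
  refine intervalIntegral.intervalIntegral_pos_of_pos_on
    ((continuous_angProfile_rpow hs).intervalIntegrable _ _) (fun θ h => ?_)
    (by positivity)
  have h1 := Real.sin_pos_of_pos_of_lt_pi h.1 (by linarith [h.2, Real.pi_pos])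
  have h2 := Real.cos_pos_of_mem_Ioo ⟨by linarith [h.1, Real.pi_pos], h.2⟩
  unfold angProfile
  positivity

/-- Jensen's inequality for the concave function `x ↦ x ^ t`. -/
lemma angMoment_mul_le {s t : ℝ} (hs : 0 ≤ s) (ht0 : 0 ≤ t) (ht1 : t ≤ 1) :
    angMoment (s * t) ≤ (angMoment s / (π / 2)) ^ t * (π / 2) := by
  set m := angMoment s / (π / 2) with hm
  have hm0 : 0 < m := div_pos (angMoment_pos hs) (by positivity)
  have key : angMoment (s * t) ≤
      ∫ θ in (0 : ℝ)..(π / 2), m ^ t * (t / m * angProfile θ ^ s + (1 - t)) := by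
    refine intervalIntegral.integral_mono_on (by positivity)
      ((continuous_angProfile_rpow (mul_nonneg hs ht0)).intervalIntegrable _ _)
      (Continuous.intervalIntegrable ?_ _ _) fun θ h => ?_
    · have := continuous_angProfile_rpow hs
      fun_prop
    · have hg := angProfile_nonneg h
      have hgs : 0 ≤ angProfile θ ^ s := Real.rpow_nonneg hg s
      have hy := Real.geom_mean_le_arith_mean2_weighted ht0 (sub_nonneg.2 ht1)
        (div_nonneg hgs hm0.le) zero_le_one (by ring)
      rw [Real.one_rpow, mul_one, Real.div_rpow hgs hm0.le, ← Real.rpow_mul hg,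
        div_le_iff₀ (Real.rpow_pos_of_pos hm0 t)] at hy
      calc angProfile θ ^ (s * t) ≤ _ := hy
        _ = _ := by ring
  refine key.trans_eq ?_
  rw [intervalIntegral.integral_const_mul, intervalIntegral.integral_add
    (((continuous_angProfile_rpow hs).const_mul _).intervalIntegrable _ _) (by simp),
    intervalIntegral.integral_const_mul, intervalIntegral.integral_const]
  change m ^ t * (t / m * angMoment s + _) = _
  have e : angMoment s = m * (π / 2) := by
    rw [hm]
    field_simp
  rw [e, smul_eq_mul]
  field_simp
  ring

lemma angMoment_two_mul_le {β : ℝ} (h0 : 0 ≤ β) (h1 : β ≤ 1) :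
    angMoment (2 * β) ≤ π / 2 * (3 * angMoment (β + 1)) ^ 2 := by
  have hb : 0 < β + 1 := by linarith
  have hM := angMoment_pos hb.le
  have hA := angMoment_mul_le hb.le (t := 2 * β / (β + 1)) (by positivity)
    ((div_le_one hb).2 (by linarith))
  have hB := angMoment_mul_le hb.le (t := 1 / (β + 1)) (by positivity)
    ((div_le_one hb).2 (by linarith))
  rw [mul_div_cancel₀ _ hb.ne'] at hA hB
  rw [angMoment_one] at hB
  set m := angMoment (β + 1) / (π / 2) with hm
  have hm0 : 0 < m := by positivity
  have hpow : m ^ (2 * β / (β + 1)) * (m ^ (1 / (β + 1))) ^ 2 = m ^ 2 := by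
    rw [← Real.rpow_natCast (m ^ (1 / (β + 1))) 2, ← Real.rpow_mul hm0.le,
      ← Real.rpow_add hm0, ← Real.rpow_natCast m 2]
    congr 1
    push_cast
    field_simp
  have hB2 : (1 / 3 : ℝ) ^ 2 ≤ (m ^ (1 / (β + 1)) * (π / 2)) ^ 2 := by gcongr
  have hAB := mul_le_mul hA hB2 (by positivity) (by positivity)
  have e : angMoment (β + 1) = m * (π / 2) := by
    rw [hm]
    field_simp
  rw [e]
  linear_combination 9 * hAB + 9 * (π / 2) ^ 3 * hpow

lemma cGamb_eq {β : ℝ} (h0 : 0 ≤ β) : cGamb β = 3 * angMoment (β + 1) := by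
  have hpi : (0 : ℝ) ≤ π / 2 := by positivity
  rw [cGamb, integral_Icc_eq_integral_Ioc, ← intervalIntegral.integral_of_le hpi, angMoment,
    ← intervalIntegral.integral_const_mul]
  refine intervalIntegral.integral_congr fun θ h => ?_
  rw [uIcc_of_le hpi] at h
  simp only [Gamb, Kker]
  rw [Real.rpow_add_of_nonneg (angProfile_nonneg h) h0 zero_le_one, Real.rpow_one]
  unfold angProfile
  ring

/-- For every `β ∈ [0,1]`, `‖Γ_β/c_β − K‖_{L²([0,π/2])} ≤ 7/10`, i.e.
`∫_0^{π/2} (Γ_β(θ)/c_β − K(θ))² dθ ≤ (7/10)²`. -/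
theorem Gamma_close_to_K (β : ℝ) (hβ : β ∈ Icc (0 : ℝ) 1) :
    ∫ θ in Icc 0 (π / 2), (Gamb β θ / cGamb β - Kker θ) ^ 2 ≤ (7 / 10) ^ 2 := by
  obtain ⟨h0, h1⟩ := hβ
  have hpi : (0 : ℝ) ≤ π / 2 := by positivity
  have hb : 0 ≤ β + 1 := by linarith
  have hM := angMoment_pos hb
  have hc := cGamb_eq h0
  have hc0 : 0 < cGamb β := by rw [hc]; positivity
  have hle := angMoment_two_mul_le h0 h1
  rw [← hc] at hle
  set c := cGamb β
  have hexp : ∫ θ in Icc 0 (π / 2), (Gamb β θ / c - Kker θ) ^ 2 =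
      ∫ θ in (0 : ℝ)..(π / 2), (1 / c ^ 2 * angProfile θ ^ (2 * β)
        - 6 / c * angProfile θ ^ (β + 1) + 9 * angProfile θ ^ 2) := by
    rw [integral_Icc_eq_integral_Ioc, ← intervalIntegral.integral_of_le hpi]
    refine intervalIntegral.integral_congr fun θ h => ?_
    rw [uIcc_of_le hpi] at h
    have hg := angProfile_nonneg h
    have hG : Gamb β θ = angProfile θ ^ β := rfl
    have hK : Kker θ = 3 * angProfile θ := by
      unfold Kker angProfile
      ring
    simp only [hG, hK]
    rw [Real.rpow_add_of_nonneg hg h0 zero_le_one, Real.rpow_one, two_mul,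
      Real.rpow_add_of_nonneg hg h0 h0]
    field_simp
    ring
  have i1 := ((continuous_angProfile_rpow (s := 2 * β) (by positivity)).const_mul
    (1 / c ^ 2)).intervalIntegrable (μ := volume) 0 (π / 2)
  have i2 := ((continuous_angProfile_rpow hb).const_mul (6 / c)).intervalIntegrable
    (μ := volume) 0 (π / 2)
  have i3 := ((continuous_angProfile.fun_pow 2).const_mul 9).intervalIntegrable
    (μ := volume) 0 (π / 2)
  rw [hexp, intervalIntegral.integral_add (i1.sub i2) i3, intervalIntegral.integral_sub i1 i2]
  simp only [intervalIntegral.integral_const_mul, integral_angProfile_sq]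
  change 1 / c ^ 2 * angMoment (2 * β) - 6 / c * angMoment (β + 1) + _ ≤ _
  have e1 : 6 / c * angMoment (β + 1) = 2 := by
    rw [hc]
    field_simp
    norm_num
  have e2 : 1 / c ^ 2 * angMoment (2 * β) ≤ π / 2 := by
    rw [one_div_mul_eq_div, div_le_iff₀ (by positivity)]
    exact hle
  rw [e1]
  linarith [Real.pi_lt_d2]
end
end

section
/- Weighted L² coercivity of 𝓛_Γ^T up to an angular-derivative term: for every α ∈ (0,1] and every admissible f, (𝓛_Γ^T(f)·w, f·w)_{L²} ≥ (1/5)‖f·w‖²_{L²} − 100‖(D_θ f)·w‖²_{L²}. -/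
open Real MeasureTheory Set Filter

noncomputable section

lemma sq_integral_mul_le_s5 {u v : ℝ → ℝ} {a b : ℝ} (hab : a ≤ b)
    (hu : ContinuousOn u (Icc a b)) (hv : ContinuousOn v (Icc a b)) :
    (∫ x in a..b, u x * v x) ^ 2 ≤ (∫ x in a..b, u x ^ 2) * ∫ x in a..b, v x ^ 2 := by
  have key : ∀ t : ℝ, 0 ≤ (∫ x in a..b, u x ^ 2) * (t * t) +
      (-2 * ∫ x in a..b, u x * v x) * t + ∫ x in a..b, v x ^ 2 := by
    intro t
    have h0 : 0 ≤ ∫ x in a..b, (t * u x - v x) ^ 2 :=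
      intervalIntegral.integral_nonneg hab fun x _ => sq_nonneg _
    have i1 : IntervalIntegrable (fun x => u x ^ 2) volume a b :=
      (hu.pow 2).intervalIntegrable_of_Icc hab
    have i2 : IntervalIntegrable (fun x => u x * v x) volume a b :=
      (hu.mul hv).intervalIntegrable_of_Icc hab
    have i3 : IntervalIntegrable (fun x => v x ^ 2) volume a b :=
      (hv.pow 2).intervalIntegrable_of_Icc hab
    have e : ∫ x in a..b, (t * u x - v x) ^ 2 =
        ∫ x in a..b, ((t * t) * u x ^ 2 + (-2 * t) * (u x * v x) + v x ^ 2) := by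
      congr 1; ext x; ring
    rw [e, intervalIntegral.integral_add ((i1.const_mul _).add (i2.const_mul _)) i3,
      intervalIntegral.integral_add (i1.const_mul _) (i2.const_mul _),
      intervalIntegral.integral_const_mul, intervalIntegral.integral_const_mul] at h0
    linarith
  have := discrim_le_zero key
  unfold discrim at this
  nlinarith

lemma Kker_eq (θ : ℝ) : Kker θ = 3 * (Real.sin θ * Real.cos θ ^ 2) := by
  unfold Kker; ring

lemma sin_mul_cos_sq_nonneg {θ : ℝ} (h : θ ∈ Icc 0 (π / 2)) :
    0 ≤ Real.sin θ * Real.cos θ ^ 2 :=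
  mul_nonneg (Real.sin_nonneg_of_nonneg_of_le_pi h.1 (by linarith [h.2, Real.pi_pos]))
    (sq_nonneg _)

lemma sin_mul_cos_sq_le {θ : ℝ} (h : θ ∈ Icc 0 (π / 2)) :
    Real.sin θ * Real.cos θ ^ 2 ≤ 2 / 5 := by
  have hs := Real.sin_nonneg_of_nonneg_of_le_pi h.1 (by linarith [h.2, Real.pi_pos])
  have h1 := Real.sin_le_one θ
  rw [Real.cos_sq']
  nlinarith [mul_nonneg hs (sq_nonneg (Real.sin θ - 29 / 50)), sq_nonneg (Real.sin θ - 29 / 50)]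

lemma Kker_mem {θ : ℝ} (h : θ ∈ Icc 0 (π / 2)) : Kker θ ∈ Icc 0 (6 / 5) := by
  rw [Kker_eq]
  constructor <;> linarith [sin_mul_cos_sq_nonneg h, sin_mul_cos_sq_le h]

lemma integral_Kker : ∫ θ in (0)..(π / 2), Kker θ = 1 := by
  have h : ∀ x ∈ uIcc 0 (π / 2), HasDerivAt (fun θ => -Real.cos θ ^ 3) (Kker x) x := by
    intro x _
    have := ((Real.hasDerivAt_cos x).pow 3).neg
    refine HasDerivAt.congr_deriv this ?_
    unfold Kker; norm_num; ring
  rw [intervalIntegral.integral_eq_sub_of_hasDerivAt h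
    (continuous_Kker.intervalIntegrable _ _)]
  simp

lemma Gam_mem {α θ : ℝ} (hα : α ∈ Ioc (0 : ℝ) 1) (h : θ ∈ Icc 0 (π / 2)) :
    Gam α θ ∈ Icc (16 / 27 * Kker θ) 1 := by
  have h0 := sin_mul_cos_sq_nonneg h
  have h1 := sin_mul_cos_sq_le h
  rw [Kker_eq]
  unfold Gam
  set x := Real.sin θ * Real.cos θ ^ 2
  refine ⟨?_, Real.rpow_le_one h0 (by linarith) (by linarith [hα.1])⟩
  have hy0 : 0 ≤ x ^ (1 / 3 : ℝ) := Real.rpow_nonneg h0 _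
  have hy3 : (x ^ (1 / 3 : ℝ)) ^ 3 = x := by
    rw [← Real.rpow_natCast, ← Real.rpow_mul h0]; norm_num
  have hle : x ^ (1 / 3 : ℝ) ≤ x ^ (α / 3) := by
    apply Real.rpow_le_rpow_of_exponent_ge_of_imp h0 (by linarith) (by linarith [hα.2])
    intro _ h3
    linarith [hα.1]
  refine le_trans ?_ hle
  set y := x ^ (1 / 3 : ℝ)
  have hy : y ≤ 3 / 4 := by
    by_contra hc
    push Not at hc
    have : (3 / 4 : ℝ) ^ 3 < y ^ 3 := by gcongr
    rw [hy3] at this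
    norm_num at this
    linarith
  rw [← hy3]
  have : y ^ 2 ≤ (3 / 4) ^ 2 := by gcongr
  nlinarith [mul_nonneg hy0 (sub_nonneg.2 this)]

lemma integral_Icc_halfPi (u : ℝ → ℝ) :
    ∫ θ in Icc 0 (π / 2), u θ = ∫ θ in (0)..(π / 2), u θ := by
  rw [integral_Icc_eq_integral_Ioc, intervalIntegral.integral_of_le (by positivity)]

lemma one_third_le_cGam {α : ℝ} (hα : α ∈ Ioc (0 : ℝ) 1) : 1 / 3 ≤ cGam α := by
  unfold cGam
  rw [integral_Icc_halfPi]
  have hK := continuous_Kker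
  have hG := continuous_Gam hα.1
  have h : ∫ θ in (0)..(π / 2), (16 / 3 * (2 / 15) * Kker θ - 16 / 3 * (1 / 25)) ≤
      ∫ θ in (0)..(π / 2), Gam α θ * Kker θ := by
    apply intervalIntegral.integral_mono_on (by positivity)
      ((by fun_prop : Continuous _).intervalIntegrable _ _)
      ((by fun_prop : Continuous _).intervalIntegrable _ _)
    intro θ hθ
    have := mul_le_mul_of_nonneg_right (Gam_mem hα hθ).1 (Kker_mem hθ).1
    nlinarith [sq_nonneg (Kker θ - 3 / 5)]
  rw [intervalIntegral.integral_sub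
    ((by fun_prop : Continuous _).intervalIntegrable _ _) (by simp),
    intervalIntegral.integral_const_mul, integral_Kker, intervalIntegral.integral_const] at h
  simp only [smul_eq_mul] at h
  nlinarith [Real.pi_lt_d2]

lemma integral_Gam_mem {α : ℝ} (hα : α ∈ Ioc (0 : ℝ) 1) :
    ∫ θ in (0)..(π / 2), Gam α θ ∈ Icc (1 / 2) (π / 2) := by
  have hK := continuous_Kker
  have hG := continuous_Gam hα.1
  constructor
  · have h : ∫ θ in (0)..(π / 2), 16 / 27 * Kker θ ≤ ∫ θ in (0)..(π / 2), Gam α θ :=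
      intervalIntegral.integral_mono_on (by positivity)
        ((by fun_prop : Continuous _).intervalIntegrable _ _)
        (hG.intervalIntegrable _ _) fun θ hθ => (Gam_mem hα hθ).1
    rw [intervalIntegral.integral_const_mul, integral_Kker] at h
    linarith
  · have h : ∫ θ in (0)..(π / 2), Gam α θ ≤ ∫ θ in (0)..(π / 2), (1 : ℝ) :=
      intervalIntegral.integral_mono_on (by positivity)
        (hG.intervalIntegrable _ _) (by simp) fun θ hθ => (Gam_mem hα hθ).2
    simpa using h

/-- A kernel of zero mean on `[0, π/2]` tests `φ` only through `sin (2θ) φ'`. -/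
lemma sq_integral_mul_le_of_integral_eq_zero {φ φ' N : ℝ → ℝ}
    (hφ : ∀ θ, HasDerivAt φ (φ' θ) θ) (hφ' : Continuous φ') (hN : Continuous N)
    (hN0 : ∫ θ in (0)..(π / 2), N θ = 0) (hNb : ∀ θ ∈ Icc 0 (π / 2), |N θ| ≤ 19 / 10) :
    (∫ θ in (0)..(π / 2), φ θ * N θ) ^ 2 ≤
      18 / 5 * ∫ θ in (0)..(π / 2), (Real.sin (2 * θ) * φ' θ) ^ 2 := by
  have hpi := Real.pi_pos
  have hpi' := Real.pi_lt_d4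
  have hφc : Continuous φ := continuous_iff_continuousAt.2 fun θ => (hφ θ).continuousAt
  set M : ℝ → ℝ := fun θ => ∫ t in (0)..θ, N t with hM
  have hMd : ∀ θ, HasDerivAt M (N θ) θ := fun θ =>
    intervalIntegral.integral_hasDerivAt_right (hN.intervalIntegrable _ _)
      (hN.stronglyMeasurableAtFilter _ _) hN.continuousAt
  have hMc : Continuous M := continuous_iff_continuousAt.2 fun θ => (hMd θ).continuousAt
  have hibp : ∫ θ in (0)..(π / 2), φ θ * N θ = -∫ θ in (0)..(π / 2), φ' θ * M θ := by
    rw [intervalIntegral.integral_mul_deriv_eq_deriv_mul (fun x _ => hφ x) (fun x _ => hMd x)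
      (hφ'.intervalIntegrable _ _) (hN.intervalIntegrable _ _)]
    simp [hM, hN0]
  have hMb : ∀ θ ∈ Icc 0 (π / 2), |M θ| ≤ 3 / 2 * Real.sin (2 * θ) := by
    intro θ hθ
    have hcase : ∀ x, 0 ≤ x → x ≤ π / 4 → 19 / 10 * x ≤ 3 / 2 * Real.sin (2 * x) := by
      intro x hx hx'
      have h1 := Real.mul_le_sin (x := 2 * x) (by linarith) (by linarith)
      have h2 : 19 / 10 * x ≤ 3 / 2 * (2 / π * (2 * x)) := by
        have : 3 / 2 * (2 / π * (2 * x)) = 6 / π * x := by field_simp; ring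
        rw [this]
        apply mul_le_mul_of_nonneg_right _ hx
        rw [le_div_iff₀ hpi]
        linarith
      linarith
    rcases le_total θ (π / 4) with hc | hc
    · have h1 : ‖∫ t in (0)..θ, N t‖ ≤ 19 / 10 * |θ - 0| := by
        apply intervalIntegral.norm_integral_le_of_norm_le_const
        intro t ht
        rw [uIoc_of_le hθ.1] at ht
        exact hNb t ⟨ht.1.le, ht.2.trans hθ.2⟩
      rw [sub_zero, abs_of_nonneg hθ.1] at h1
      exact h1.trans (hcase θ hθ.1 hc)
    · have h1 : ‖∫ t in θ..(π / 2), N t‖ ≤ 19 / 10 * |π / 2 - θ| := by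
        apply intervalIntegral.norm_integral_le_of_norm_le_const
        intro t ht
        rw [uIoc_of_le hθ.2] at ht
        exact hNb t ⟨hθ.1.trans ht.1.le, ht.2⟩
      have h2 : M θ = -∫ t in θ..(π / 2), N t := by
        have := intervalIntegral.integral_add_adjacent_intervals
          (hN.intervalIntegrable (μ := volume) 0 θ) (hN.intervalIntegrable θ (π / 2))
        simp only [hM]
        linarith
      rw [abs_of_nonneg (by linarith [hθ.2])] at h1
      have h3 := hcase (π / 2 - θ) (by linarith [hθ.2]) (by linarith)
      rw [show 2 * (π / 2 - θ) = π - 2 * θ by ring, Real.sin_pi_sub] at h3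
      rw [h2, abs_neg]
      exact h1.trans h3
  have hb : |∫ θ in (0)..(π / 2), φ θ * N θ| ≤
      ∫ θ in (0)..(π / 2), (3 / 2) * |Real.sin (2 * θ) * φ' θ| := by
    rw [hibp, abs_neg]
    refine (intervalIntegral.abs_integral_le_integral_abs (by positivity)).trans ?_
    apply intervalIntegral.integral_mono_on (by positivity)
      ((by fun_prop : Continuous _).intervalIntegrable _ _)
      ((by fun_prop : Continuous _).intervalIntegrable _ _)
    intro θ hθ
    have hs : 0 ≤ Real.sin (2 * θ) :=
      Real.sin_nonneg_of_nonneg_of_le_pi (by linarith [hθ.1]) (by linarith [hθ.2])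
    rw [abs_mul, abs_mul, abs_of_nonneg hs]
    nlinarith [mul_le_mul_of_nonneg_left (hMb θ hθ) (abs_nonneg (φ' θ))]
  have hcs := sq_integral_mul_le_s5 (u := fun _ => (3 / 2 : ℝ))
    (v := fun θ => |Real.sin (2 * θ) * φ' θ|) (a := 0) (b := π / 2) (by positivity)
    (by fun_prop) (by fun_prop)
  simp only [sq_abs, intervalIntegral.integral_const, smul_eq_mul] at hcs
  have h0 : 0 ≤ ∫ θ in (0)..(π / 2), (Real.sin (2 * θ) * φ' θ) ^ 2 :=
    intervalIntegral.integral_nonneg (by positivity) fun x _ => sq_nonneg _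
  have := pow_le_pow_left₀ (abs_nonneg _) hb 2
  rw [sq_abs] at this
  refine this.trans (hcs.trans ?_)
  apply mul_le_mul_of_nonneg_right _ h0
  linarith

lemma sq_integral_mul_Gam_sub_le {α : ℝ} (hα : α ∈ Ioc (0 : ℝ) 1) {φ φ' : ℝ → ℝ}
    (hφ : ∀ θ, HasDerivAt φ (φ' θ) θ) (hφ' : Continuous φ') :
    ((∫ θ in (0)..(π / 2), φ θ * Gam α θ) -
      (∫ θ in (0)..(π / 2), Gam α θ) * ∫ θ in (0)..(π / 2), φ θ * Kker θ) ^ 2 ≤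
      18 / 5 * ∫ θ in (0)..(π / 2), (Real.sin (2 * θ) * φ' θ) ^ 2 := by
  have hK := continuous_Kker
  have hG := continuous_Gam hα.1
  have hφc : Continuous φ := continuous_iff_continuousAt.2 fun θ => (hφ θ).continuousAt
  obtain ⟨hg0, hg1⟩ := integral_Gam_mem hα
  set g := ∫ θ in (0)..(π / 2), Gam α θ with hg
  have e : (∫ θ in (0)..(π / 2), φ θ * Gam α θ) - g * ∫ θ in (0)..(π / 2), φ θ * Kker θ =
      ∫ θ in (0)..(π / 2), φ θ * (Gam α θ - g * Kker θ) := by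
    rw [← intervalIntegral.integral_const_mul, ← intervalIntegral.integral_sub
      ((by fun_prop : Continuous _).intervalIntegrable _ _)
      ((by fun_prop : Continuous _).intervalIntegrable _ _)]
    congr 1; ext θ; ring
  rw [e]
  apply sq_integral_mul_le_of_integral_eq_zero hφ hφ' (by fun_prop)
  · rw [intervalIntegral.integral_sub (hG.intervalIntegrable _ _)
      ((by fun_prop : Continuous _).intervalIntegrable _ _),
      intervalIntegral.integral_const_mul, integral_Kker, ← hg]
    ring
  · intro θ hθ
    have h1 := Gam_mem hα hθ
    have h2 := Kker_mem hθ
    have hpi' := Real.pi_lt_d2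
    have h3 : g * Kker θ ≤ 1.575 * (6 / 5) :=
      mul_le_mul (by linarith) h2.2 h2.1 (by norm_num)
    have h4 : 0 ≤ g * Kker θ := mul_nonneg (by linarith) h2.1
    rw [abs_le]
    constructor <;> linarith [h1.1, h1.2, h2.1]

lemma hasDerivAt_wgt {z : ℝ} (hz : 0 < z) : HasDerivAt wgt (-2 * (1 + z) / z ^ 3) z := by
  have h1 : HasDerivAt (fun z : ℝ => (1 + z) ^ 2) (2 * (1 + z)) z := by
    simpa using ((hasDerivAt_id z).const_add 1).fun_pow 2
  have h2 : HasDerivAt (fun z : ℝ => z ^ 2) (2 * z) z := by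
    simpa using (hasDerivAt_id z).fun_pow 2
  refine (h1.div h2 (by positivity)).congr_deriv ?_
  field_simp
  ring

lemma continuousOn_wgt {a b : ℝ} (ha : 0 < a) : ContinuousOn wgt (Icc a b) :=
  fun _ hz => (hasDerivAt_wgt (ha.trans_le hz.1)).continuousAt.continuousWithinAt

lemma integral_inv_one_add_sq_le_one {a b : ℝ} (ha : 0 < a) (hab : a ≤ b) :
    ∫ z in a..b, (1 / (1 + z)) ^ 2 ≤ 1 := by
  have hd : ∀ z ∈ uIcc a b, HasDerivAt (fun z : ℝ => -(1 / (1 + z))) ((1 / (1 + z)) ^ 2) z := by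
    intro z hz
    rw [uIcc_of_le hab] at hz
    have hz0 : 1 + z ≠ 0 := by linarith [hz.1]
    have := (((hasDerivAt_id z).const_add 1).inv hz0).neg
    refine (this.congr_deriv (by simp; field_simp)).congr_of_eventuallyEq ?_
    filter_upwards with x
    simp
  have hz1 : ∀ z ∈ Icc a b, 1 + z ≠ 0 := fun z hz => by linarith [hz.1]
  have hc : ContinuousOn (fun z : ℝ => (1 / (1 + z)) ^ 2) (Icc a b) := by
    fun_prop (disch := assumption)
  rw [intervalIntegral.integral_eq_sub_of_hasDerivAt hd (hc.intervalIntegrable_of_Icc hab)]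
  have h1 : 0 < 1 / (1 + b) := one_div_pos.2 (by linarith)
  have h2 : 1 / (1 + a) ≤ 1 := by rw [div_le_one (by linarith)]; linarith
  linarith

/-- The pointwise estimate behind `radial_coercivity`: the integrand dominates the derivative of
`z w² A / 2 + (g / c) w ℓ²` up to controlled terms. -/
lemma radial_pointwise {z c g L A E B p q e l : ℝ} (hz : 0 < z) (hc : 1 / 3 ≤ c) (hg : 1 / 2 ≤ g)
    (hB : 0 ≤ B) (hh : (p - g * q) ^ 2 ≤ 18 / 5 * B)
    (he : 3 / (1 + z) * e ≤ 1 / 10 * A + 45 / 2 * B) :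
    (wgt z ^ 2 * (1 - 4 / (1 + z)) * A / 2 + z * wgt z ^ 2 * E +
      g / c * (-2 * (1 + z) / z ^ 3 * l ^ 2 + 2 * wgt z * l * (-(q / z)))) +
      (2 / 5 * (wgt z ^ 2 * A) - 333 / 10 * (wgt z ^ 2 * B) +
        2 / c * L * (1 / (1 + z) * (wgt z * p))) ≤
    wgt z ^ 2 * (A + z * E - 2 * A / (1 + z) - 2 * z / (c * (1 + z) ^ 2) * l * p -
      3 / (1 + z) * e + 2 * z ^ 2 / (c * (1 + z) ^ 3) * L * p) := by
  have hc0 : 0 < c := by linarith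
  have hw : 0 ≤ wgt z ^ 2 := sq_nonneg _
  have hid : wgt z ^ 2 * (A + z * E - 2 * A / (1 + z) - 2 * z / (c * (1 + z) ^ 2) * l * p -
      3 / (1 + z) * e + 2 * z ^ 2 / (c * (1 + z) ^ 3) * L * p) -
      ((wgt z ^ 2 * (1 - 4 / (1 + z)) * A / 2 + z * wgt z ^ 2 * E +
      g / c * (-2 * (1 + z) / z ^ 3 * l ^ 2 + 2 * wgt z * l * (-(q / z)))) +
      (2 / 5 * (wgt z ^ 2 * A) - 333 / 10 * (wgt z ^ 2 * B) +
        2 / c * L * (1 / (1 + z) * (wgt z * p)))) =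
      wgt z ^ 2 * (1 / 10 * A + 45 / 2 * B - 3 / (1 + z) * e) +
      1 / c * (2 * g * (l / z) ^ 2 - 2 * (l / z) * (wgt z * (p - g * q)) +
        54 / 5 * c * (wgt z ^ 2 * B) + 2 * g * (l / z) ^ 2 / z) := by
    unfold wgt
    field_simp
    ring
  have h1 : 0 ≤ wgt z ^ 2 * (1 / 10 * A + 45 / 2 * B - 3 / (1 + z) * e) :=
    mul_nonneg hw (by linarith)
  have h2 : (wgt z * (p - g * q)) ^ 2 ≤ 18 / 5 * (wgt z ^ 2 * B) := by
    nlinarith [mul_le_mul_of_nonneg_left hh hw]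
  have h3 : 0 ≤ 2 * g * (l / z) ^ 2 / z := by positivity
  have h4 : 0 ≤ wgt z ^ 2 * B := mul_nonneg hw hB
  have h5 : 0 ≤ 2 * g * (l / z) ^ 2 - 2 * (l / z) * (wgt z * (p - g * q)) +
      54 / 5 * c * (wgt z ^ 2 * B) + 2 * g * (l / z) ^ 2 / z := by
    nlinarith [sq_nonneg (l / z - wgt z * (p - g * q)),
      mul_nonneg (sub_nonneg.2 hc) h4, mul_nonneg (sub_nonneg.2 hg) (sq_nonneg (l / z))]
  have h6 := mul_nonneg (one_div_pos.2 hc0).le h5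
  linarith

lemma radial_coercivity {a b c g L : ℝ} {A E B p q e l : ℝ → ℝ} (ha : 0 < a) (hab : a ≤ b)
    (hc : 1 / 3 ≤ c) (hg : 1 / 2 ≤ g)
    (hEc : Continuous E) (hBc : Continuous B) (hpc : Continuous p) (hqc : Continuous q)
    (hec : Continuous e)
    (hA : ∀ z, HasDerivAt A (2 * E z) z)
    (hl : ∀ z ∈ Icc a b, HasDerivAt l (-(q z / z)) z)
    (hAa : A a = 0) (hAb : A b = 0) (hla : l a = 0) (hlb : l b = 0)
    (hB : ∀ z, 0 ≤ B z) (hp : ∀ z, p z ^ 2 ≤ 8 / 5 * A z)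
    (hh : ∀ z, (p z - g * q z) ^ 2 ≤ 18 / 5 * B z)
    (he : ∀ z, 0 < z → 3 / (1 + z) * e z ≤ 1 / 10 * A z + 45 / 2 * B z)
    (hL : L ^ 2 ≤ 27 / 40 * ∫ z in a..b, wgt z ^ 2 * B z) :
    1 / 5 * (∫ z in a..b, wgt z ^ 2 * A z) - 100 * (∫ z in a..b, wgt z ^ 2 * B z) ≤
    ∫ z in a..b, wgt z ^ 2 * (A z + z * E z - 2 * A z / (1 + z) -
      2 * z / (c * (1 + z) ^ 2) * l z * p z - 3 / (1 + z) * e z +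
      2 * z ^ 2 / (c * (1 + z) ^ 3) * L * p z) := by
  have hc0 : 0 < c := by linarith
  have hAc : Continuous A := continuous_iff_continuousAt.2 fun z => (hA z).continuousAt
  have hlc : ContinuousOn l (Icc a b) := fun z hz => (hl z hz).continuousAt.continuousWithinAt
  have hwc : ContinuousOn wgt (Icc a b) := continuousOn_wgt ha
  have hz1 : ∀ z ∈ Icc a b, z ≠ 0 := fun z hz => (ha.trans_le hz.1).ne'
  have hz2 : ∀ z ∈ Icc a b, 1 + z ≠ 0 := fun z hz => by linarith [hz.1]
  have hz3 : ∀ z ∈ Icc a b, z ^ 3 ≠ 0 := fun z hz => pow_ne_zero _ (hz1 z hz)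
  have hz4 : ∀ z ∈ Icc a b, c * (1 + z) ^ 2 ≠ 0 := fun z hz =>
    mul_ne_zero hc0.ne' (pow_ne_zero _ (hz2 z hz))
  have hz5 : ∀ z ∈ Icc a b, c * (1 + z) ^ 3 ≠ 0 := fun z hz =>
    mul_ne_zero hc0.ne' (pow_ne_zero _ (hz2 z hz))
  set Φ' : ℝ → ℝ := fun z => wgt z ^ 2 * (1 - 4 / (1 + z)) * A z / 2 + z * wgt z ^ 2 * E z +
      g / c * (-2 * (1 + z) / z ^ 3 * l z ^ 2 + 2 * wgt z * l z * (-(q z / z))) with hΦ'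
  have hΦd : ∀ z ∈ uIcc a b, HasDerivAt
      (fun z => z * wgt z ^ 2 * A z / 2 + g / c * (wgt z * l z ^ 2)) (Φ' z) z := by
    intro z hz
    rw [uIcc_of_le hab] at hz
    have hz0 : 0 < z := ha.trans_le hz.1
    have hw := hasDerivAt_wgt hz0
    have := ((((hasDerivAt_id z).mul (hw.pow 2)).mul (hA z)).div_const 2).add
      ((hw.mul ((hl z hz).pow 2)).const_mul (g / c))
    refine this.congr_deriv ?_
    simp only [hΦ', id, Pi.mul_apply, Pi.pow_apply]
    unfold wgt
    norm_num
    field_simp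
    ring
  have hΦc : ContinuousOn Φ' (Icc a b) := by
    simp only [hΦ']
    fun_prop (disch := assumption)
  have hΦi := hΦc.intervalIntegrable_of_Icc (μ := volume) hab
  have hΦ0 : ∫ z in a..b, Φ' z = 0 := by
    rw [intervalIntegral.integral_eq_sub_of_hasDerivAt hΦd hΦi]
    simp [hAa, hAb, hla, hlb]
  have iA : IntervalIntegrable (fun z => wgt z ^ 2 * A z) volume a b :=
    ContinuousOn.intervalIntegrable_of_Icc hab (by fun_prop)
  have iB : IntervalIntegrable (fun z => wgt z ^ 2 * B z) volume a b :=
    ContinuousOn.intervalIntegrable_of_Icc hab (by fun_prop)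
  have iP : IntervalIntegrable (fun z => 1 / (1 + z) * (wgt z * p z)) volume a b :=
    ContinuousOn.intervalIntegrable_of_Icc hab (by fun_prop (disch := assumption))
  have hmono := intervalIntegral.integral_mono_on hab
    (hΦi.add (((iA.const_mul (2 / 5)).sub (iB.const_mul (333 / 10))).add
      (iP.const_mul (2 / c * L))))
    (ContinuousOn.intervalIntegrable_of_Icc hab (by fun_prop (disch := assumption)) :
      IntervalIntegrable (fun z => wgt z ^ 2 * (A z + z * E z - 2 * A z / (1 + z) -
      2 * z / (c * (1 + z) ^ 2) * l z * p z - 3 / (1 + z) * e z +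
      2 * z ^ 2 / (c * (1 + z) ^ 3) * L * p z)) volume a b)
    (fun z hz => radial_pointwise (ha.trans_le hz.1) hc hg (hB z) (hh z)
      (he z (ha.trans_le hz.1)))
  rw [intervalIntegral.integral_add hΦi (((iA.const_mul (2 / 5)).sub
    (iB.const_mul (333 / 10))).add (iP.const_mul (2 / c * L))),
    intervalIntegral.integral_add ((iA.const_mul (2 / 5)).sub (iB.const_mul (333 / 10)))
      (iP.const_mul (2 / c * L)),
    intervalIntegral.integral_sub (iA.const_mul (2 / 5)) (iB.const_mul (333 / 10)),
    intervalIntegral.integral_const_mul, intervalIntegral.integral_const_mul,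
    intervalIntegral.integral_const_mul, hΦ0] at hmono
  have hP := sq_integral_mul_le_s5 (u := fun z => 1 / (1 + z)) (v := fun z => wgt z * p z) hab
    (by fun_prop (disch := assumption)) (by fun_prop)
  have hwp : ∫ z in a..b, (wgt z * p z) ^ 2 ≤ 8 / 5 * ∫ z in a..b, wgt z ^ 2 * A z := by
    rw [← intervalIntegral.integral_const_mul]
    apply intervalIntegral.integral_mono_on hab
      (ContinuousOn.intervalIntegrable_of_Icc hab (by fun_prop)) (iA.const_mul _)
    intro z _
    nlinarith [mul_le_mul_of_nonneg_left (hp z) (sq_nonneg (wgt z))]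
  have hwp0 : 0 ≤ ∫ z in a..b, (wgt z * p z) ^ 2 :=
    intervalIntegral.integral_nonneg hab fun x _ => sq_nonneg _
  have hP' := hP.trans (mul_le_of_le_one_left hwp0 (integral_inv_one_add_sq_le_one ha hab))
  set P := ∫ z in a..b, 1 / (1 + z) * (wgt z * p z)
  have hcL : -(6 * |L * P|) ≤ 2 / c * L * P := by
    have h1 : 2 / c ≤ 6 := by rw [div_le_iff₀ hc0]; linarith
    have h2 : 0 ≤ 2 / c := by positivity
    nlinarith [mul_le_mul_of_nonneg_right h1 (abs_nonneg (L * P)),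
      mul_le_mul_of_nonneg_left (neg_abs_le (L * P)) h2]
  have hLP : 6 * |L * P| ≤ P ^ 2 / 8 + 72 * L ^ 2 := by
    rw [abs_mul]
    nlinarith [sq_nonneg (|P| - 24 * |L|), sq_abs P, sq_abs L]
  have hB0 : 0 ≤ ∫ z in a..b, wgt z ^ 2 * B z :=
    intervalIntegral.integral_nonneg hab fun x _ => mul_nonneg (sq_nonneg _) (hB x)
  linarith

lemma hasDerivAt_integral_param {G G' : ℝ → ℝ → ℝ} (u v : ℝ)
    (hG : ∀ z θ, HasDerivAt (fun s => G s θ) (G' z θ) z)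
    (hGc : Continuous (Function.uncurry G)) (hG'c : Continuous (Function.uncurry G')) (z : ℝ) :
    HasDerivAt (fun s => ∫ θ in u..v, G s θ) (∫ θ in u..v, G' z θ) z := by
  obtain ⟨C, hC⟩ := ((isCompact_Icc (a := z - 1) (b := z + 1)).prod
    (isCompact_uIcc (a := u) (b := v))).exists_bound_of_continuousOn hG'c.continuousOn
  refine (intervalIntegral.hasDerivAt_integral_of_dominated_loc_of_deriv_le
    (s := Icc (z - 1) (z + 1)) (bound := fun _ => C)
    (Icc_mem_nhds (by linarith) (by linarith)) ?_ ?_ ?_ ?_ (by simp) ?_).2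
  · exact Eventually.of_forall fun x =>
      (by fun_prop : Continuous fun θ => G x θ).aestronglyMeasurable
  · exact (by fun_prop : Continuous fun θ => G z θ).intervalIntegrable _ _
  · exact (by fun_prop : Continuous fun θ => G' z θ).aestronglyMeasurable
  · exact Eventually.of_forall fun t ht x hx => hC (x, t) ⟨hx, uIoc_subset_uIcc ht⟩
  · exact Eventually.of_forall fun t _ x _ => hG x t

lemma hasDerivAt_fst {f : ℝ → ℝ → ℝ} (hf : ContDiff ℝ (⊤ : ℕ∞) (Function.uncurry f)) (z θ : ℝ) :
    HasDerivAt (fun s => f s θ) (fderiv ℝ (Function.uncurry f) (z, θ) (1, 0)) z := by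
  have h := (hf.differentiable (by simp) (z, θ)).hasFDerivAt
  exact h.comp_hasDerivAt z ((hasDerivAt_id z).prodMk (hasDerivAt_const z θ))

lemma hasDerivAt_snd {f : ℝ → ℝ → ℝ} (hf : ContDiff ℝ (⊤ : ℕ∞) (Function.uncurry f)) (z θ : ℝ) :
    HasDerivAt (fun t => f z t) (fderiv ℝ (Function.uncurry f) (z, θ) (0, 1)) θ := by
  have h := (hf.differentiable (by simp) (z, θ)).hasFDerivAt
  exact h.comp_hasDerivAt θ ((hasDerivAt_const θ z).prodMk (hasDerivAt_id θ))

lemma continuous_deriv_fst {f : ℝ → ℝ → ℝ} (hf : ContDiff ℝ (⊤ : ℕ∞) (Function.uncurry f)) :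
    Continuous (Function.uncurry fun z θ => deriv (fun s => f s θ) z) := by
  have h := hf.continuous_fderiv (by simp)
  have e : (Function.uncurry fun z θ => deriv (fun s => f s θ) z) =
      fun x => fderiv ℝ (Function.uncurry f) x (1, 0) := by
    ext ⟨z, θ⟩; exact (hasDerivAt_fst hf z θ).deriv
  rw [e]; fun_prop

lemma continuous_deriv_snd {f : ℝ → ℝ → ℝ} (hf : ContDiff ℝ (⊤ : ℕ∞) (Function.uncurry f)) :
    Continuous (Function.uncurry fun z θ => deriv (fun t => f z t) θ) := by
  have h := hf.continuous_fderiv (by simp)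
  have e : (Function.uncurry fun z θ => deriv (fun t => f z t) θ) =
      fun x => fderiv ℝ (Function.uncurry f) x (0, 1) := by
    ext ⟨z, θ⟩; exact (hasDerivAt_snd hf z θ).deriv
  rw [e]; fun_prop

lemma setIntegral_Ioi_eq_intervalIntegral {G : ℝ → ℝ} {m a b : ℝ} (hma : m ≤ a) (hab : a ≤ b)
    (hG : ∀ z, m < z → z ∉ Ioc a b → G z = 0) :
    ∫ z in Ioi m, G z = ∫ z in a..b, G z := by
  rw [intervalIntegral.integral_of_le hab]
  exact setIntegral_eq_of_subset_of_forall_sdiff_eq_zero measurableSet_Ioi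
    (fun z hz => hma.trans_lt hz.1) fun z hz => hG z hz.1 hz.2

lemma L12_eq_s5 {G : ℝ → ℝ → ℝ} {m a b : ℝ} (hma : m ≤ a) (hab : a ≤ b)
    (hG : ∀ z, m < z → z ∉ Ioc a b → ∀ θ, G z θ = 0) :
    L12 G m = ∫ r in a..b, (∫ θ in (0)..(π / 2), G r θ * Kker θ) / r := by
  unfold L12
  simp only [integral_Icc_halfPi, intervalIntegral.integral_div]
  apply setIntegral_Ioi_eq_intervalIntegral hma hab
  intro z hz hz'
  simp [hG z hz hz']

lemma ip_eq {F G : ℝ → ℝ → ℝ} {a b : ℝ} (ha : 0 < a) (hab : a ≤ b)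
    (hG : ∀ z, z ∉ Ioo a b → ∀ θ, G z θ = 0) :
    ip F G = ∫ z in a..b, ∫ θ in (0)..(π / 2), F z θ * G z θ := by
  unfold ip
  simp only [integral_Icc_halfPi]
  apply setIntegral_Ioi_eq_intervalIntegral ha.le hab
  intro z _ hz
  simp [hG z fun h => hz (Ioo_subset_Ioc_self h)]

/-- Weighted `L²` coercivity of `𝓛_Γ^T` up to an angular-derivative term: for every
`α ∈ (0,1]` and admissible `f` with `L₁₂(f)(0) = 0`,
`(𝓛_Γ^T(f)·w, f·w)_{L²} ≥ (1/5)‖f·w‖² − 100‖(D_θ f)·w‖²`. -/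
theorem LGamT_coercive (α : ℝ) (hα : α ∈ Ioc (0 : ℝ) 1)
    (f : ℝ → ℝ → ℝ) (hf : Admissible f) (hf0 : L12 f 0 = 0) :
    ip (fun z θ => LGamT α f z θ * wgt z) (fun z θ => f z θ * wgt z) ≥
      (1 / 5) * ip (fun z θ => f z θ * wgt z) (fun z θ => f z θ * wgt z) -
        100 * ip (fun z θ => Dth f z θ * wgt z) (fun z θ => Dth f z θ * wgt z) := by
  obtain ⟨hfc, a₀, b₀, ha₀, hsupp⟩ := hf
  obtain ⟨a, b, ha, hab, hs⟩ : ∃ a b : ℝ, 0 < a ∧ a ≤ b ∧ ∀ z, z ∉ Ioo a b → ∀ θ, f z θ = 0 := by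
    refine ⟨a₀ / 2, |b₀| + a₀, by positivity, by linarith [abs_nonneg b₀], fun z hz θ => ?_⟩
    apply hsupp
    exact fun h => hz ⟨by linarith [h.1], by linarith [h.2, le_abs_self b₀]⟩
  have hDs : ∀ z, z ∉ Ioo a b → ∀ θ, Dth f z θ = 0 := by
    intro z hz θ
    have : (fun t => f z t) = fun _ => 0 := funext (hs z hz)
    simp [Dth, this]
  have hIoo : ∀ z, z ∉ Ioc a b → z ∉ Ioo a b := fun z hz h => hz (Ioo_subset_Ioc_self h)
  have hK := continuous_Kker
  have hG := continuous_Gam hα.1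
  have hFc : Continuous (Function.uncurry f) := hfc.continuous
  have hz' := continuous_deriv_fst hfc
  have hθ' := continuous_deriv_snd hfc
  have hDc : Continuous (Function.uncurry (Dth f)) := by
    have : Function.uncurry (Dth f) = fun x => Real.sin (2 * x.2) *
      (Function.uncurry fun z θ => deriv (fun t => f z t) θ) x := rfl
    rw [this]
    fun_prop
  set fz : ℝ → ℝ → ℝ := fun z θ => deriv (fun s => f s θ) z with hfz
  have hfzd : ∀ z θ, HasDerivAt (fun s => f s θ) (fz z θ) z := fun z θ =>
    (hasDerivAt_fst hfc z θ).differentiableAt.hasDerivAt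
  have hc := one_third_le_cGam hα
  have hg := integral_Gam_mem hα
  set A : ℝ → ℝ := fun z => ∫ θ in (0)..(π / 2), f z θ ^ 2 with hA
  set E : ℝ → ℝ := fun z => ∫ θ in (0)..(π / 2), f z θ * fz z θ with hE
  set B : ℝ → ℝ := fun z => ∫ θ in (0)..(π / 2), Dth f z θ ^ 2 with hB
  set p : ℝ → ℝ := fun z => ∫ θ in (0)..(π / 2), f z θ * Gam α θ with hp
  set q : ℝ → ℝ := fun z => ∫ θ in (0)..(π / 2), f z θ * Kker θ with hq
  set e : ℝ → ℝ := fun z => ∫ θ in (0)..(π / 2), f z θ * Dth f z θ with he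
  set d : ℝ → ℝ := fun z => ∫ θ in (0)..(π / 2), Dth f z θ * Kker θ with hd
  set L : ℝ := L12 (fun z2 θ2 => 3 / (1 + z2) * Dth f z2 θ2) 0 with hL
  have hpar : ∀ G : ℝ → ℝ → ℝ, Continuous (Function.uncurry G) →
      Continuous fun z => ∫ θ in (0)..(π / 2), G z θ := fun G hG =>
    intervalIntegral.continuous_parametric_intervalIntegral_of_continuous' hG _ _
  have hEc : Continuous E := hpar _ (by fun_prop)
  have hBc : Continuous B := hpar _ (by fun_prop)
  have hpc : Continuous p := hpar _ (by fun_prop)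
  have hqc : Continuous q := hpar _ (by fun_prop)
  have hec : Continuous e := hpar _ (by fun_prop)
  have hdc : Continuous d := hpar _ (by fun_prop)
  have hAd : ∀ z, HasDerivAt A (2 * E z) z := by
    intro z
    have := hasDerivAt_integral_param (G := fun z θ => f z θ ^ 2)
      (G' := fun z θ => 2 * (f z θ * fz z θ)) 0 (π / 2)
      (fun z θ => ((hfzd z θ).fun_pow 2).congr_deriv (by norm_num; ring))
      (by fun_prop) (by fun_prop) z
    rwa [intervalIntegral.integral_const_mul] at this
  have hA0 : ∀ z, 0 ≤ A z := fun z =>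
    intervalIntegral.integral_nonneg (by positivity) fun _ _ => sq_nonneg _
  have hB0 : ∀ z, 0 ≤ B z := fun z =>
    intervalIntegral.integral_nonneg (by positivity) fun _ _ => sq_nonneg _
  have hl : ∀ z ∈ Icc a b, L12 f z = ∫ r in z..b, q r / r := fun z hz =>
    L12_eq_s5 le_rfl hz.2 fun r hr hr' => hs r fun h => hr' ⟨hr, h.2.le⟩
  have hqi : ∀ z, 0 < z → ContinuousAt (fun r => q r / r) z := fun z hz =>
    hqc.continuousAt.div continuousAt_id hz.ne'
  have hld : ∀ z ∈ Icc a b,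
      HasDerivAt (fun z => ∫ r in z..b, q r / r) (-(q z / z)) z := by
    intro z hz
    apply intervalIntegral.integral_hasDerivAt_left
    · apply ContinuousOn.intervalIntegrable_of_Icc hz.2
      exact fun r hr => (hqi r (ha.trans_le (hz.1.trans hr.1))).continuousWithinAt
    · exact (hqc.measurable.div measurable_id).stronglyMeasurable.stronglyMeasurableAtFilter
    · exact hqi z (ha.trans_le hz.1)
  have hla : ∫ r in a..b, q r / r = 0 := by
    rw [← hf0]
    exact (L12_eq_s5 ha.le hab fun r _ hr => hs r (hIoo r hr)).symm
  have hpA : ∀ z, p z ^ 2 ≤ 8 / 5 * A z := by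
    intro z
    have h1 := sq_integral_mul_le_s5 (u := fun θ => f z θ) (v := Gam α) (a := 0) (b := π / 2)
      (by positivity) (by fun_prop) (by fun_prop)
    have h2 : ∫ θ in (0)..(π / 2), Gam α θ ^ 2 ≤ 8 / 5 := by
      refine le_trans (intervalIntegral.integral_mono_on (g := Gam α) (by positivity)
        ((by fun_prop : Continuous _).intervalIntegrable _ _) (hG.intervalIntegrable _ _) ?_)
        (hg.2.trans (by linarith [Real.pi_lt_d2]))
      intro θ hθ
      have h3 := Gam_mem hα hθ
      nlinarith [h3.1, h3.2, (Kker_mem hθ).1]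
    nlinarith [mul_le_mul_of_nonneg_left h2 (hA0 z)]
  have hdB : ∀ z, d z ^ 2 ≤ 6 / 5 * B z := by
    intro z
    have h1 := sq_integral_mul_le_s5 (u := fun θ => Dth f z θ) (v := Kker) (a := 0) (b := π / 2)
      (by positivity) (by fun_prop) (by fun_prop)
    have h2 : ∫ θ in (0)..(π / 2), Kker θ ^ 2 ≤ ∫ θ in (0)..(π / 2), 6 / 5 * Kker θ := by
      apply intervalIntegral.integral_mono_on (by positivity)
        ((by fun_prop : Continuous _).intervalIntegrable _ _)
        ((by fun_prop : Continuous _).intervalIntegrable _ _)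
      intro θ hθ
      have h3 := Kker_mem hθ
      nlinarith [h3.1, h3.2]
    rw [intervalIntegral.integral_const_mul, integral_Kker] at h2
    nlinarith [mul_le_mul_of_nonneg_left h2 (hB0 z)]
  have heb : ∀ z, 0 < z → 3 / (1 + z) * e z ≤ 1 / 10 * A z + 45 / 2 * B z := by
    intro z hz
    simp only [he, hA, hB]
    rw [← intervalIntegral.integral_const_mul, ← intervalIntegral.integral_const_mul,
      ← intervalIntegral.integral_const_mul, ← intervalIntegral.integral_add
      ((by fun_prop : Continuous _).intervalIntegrable _ _)
      ((by fun_prop : Continuous _).intervalIntegrable _ _)]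
    apply intervalIntegral.integral_mono_on (by positivity)
      ((by fun_prop : Continuous _).intervalIntegrable _ _)
      ((by fun_prop : Continuous _).intervalIntegrable _ _)
    intro θ _
    have h1 : 3 / (1 + z) ≤ 3 := div_le_self (by norm_num) (by linarith)
    have h2 : 0 ≤ 3 / (1 + z) := by positivity
    have h3 := mul_le_mul_of_nonneg_left (le_abs_self (f z θ * Dth f z θ)) h2
    have h4 := mul_le_mul_of_nonneg_right h1 (abs_nonneg (f z θ * Dth f z θ))
    have h5 : 3 * |f z θ * Dth f z θ| ≤ 1 / 10 * f z θ ^ 2 + 45 / 2 * Dth f z θ ^ 2 := by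
      rw [abs_mul, ← sq_abs (f z θ), ← sq_abs (Dth f z θ)]
      nlinarith [sq_nonneg (|f z θ| - 15 * |Dth f z θ|)]
    linarith
  have hwc : ContinuousOn wgt (Icc a b) := continuousOn_wgt ha
  have hz1 : ∀ z ∈ Icc a b, 1 + z ≠ 0 := fun z hz => by linarith [hz.1]
  have hz3 : ∀ z ∈ Icc a b, (1 + z) ^ 3 ≠ 0 := fun z hz => pow_ne_zero _ (hz1 z hz)
  have hLb : L ^ 2 ≤ 27 / 40 * ∫ z in a..b, wgt z ^ 2 * B z := by
    have hLe : L = 3 * ∫ r in a..b, r / (1 + r) ^ 3 * (wgt r * d r) := by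
      rw [hL, L12_eq_s5 ha.le hab fun r _ hr θ => by rw [hDs r (hIoo r hr), mul_zero],
        ← intervalIntegral.integral_const_mul]
      apply intervalIntegral.integral_congr
      intro r hr
      rw [uIcc_of_le hab] at hr
      have hr0 : 0 < r := ha.trans_le hr.1
      have : ∫ θ in (0)..(π / 2), 3 / (1 + r) * Dth f r θ * Kker θ = 3 / (1 + r) * d r := by
        rw [hd, ← intervalIntegral.integral_const_mul]
        simp only [mul_assoc]
      simp only [this]
      unfold wgt
      field_simp
    have h1 := sq_integral_mul_le_s5 (u := fun r => r / (1 + r) ^ 3) (v := fun r => wgt r * d r) hab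
      (by fun_prop (disch := assumption)) (by fun_prop)
    have h2 : ∫ r in a..b, (r / (1 + r) ^ 3) ^ 2 ≤ 1 / 16 := by
      have h3 : ∫ r in a..b, (r / (1 + r) ^ 3) ^ 2 ≤
          ∫ r in a..b, 1 / 16 * (1 / (1 + r)) ^ 2 := by
        apply intervalIntegral.integral_mono_on hab
          (ContinuousOn.intervalIntegrable_of_Icc hab (by fun_prop (disch := assumption)))
          (ContinuousOn.intervalIntegrable_of_Icc hab (by fun_prop (disch := assumption)))
        intro r hr
        have hr0 : 0 < r := ha.trans_le hr.1
        have h4 : r / (1 + r) ^ 2 ≤ 1 / 4 := by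
          rw [div_le_iff₀ (by positivity)]
          nlinarith [sq_nonneg (1 - r)]
        have h5 : (r / (1 + r) ^ 3) ^ 2 = (r / (1 + r) ^ 2) ^ 2 * (1 / (1 + r)) ^ 2 := by
          field_simp
        rw [h5]
        apply mul_le_mul_of_nonneg_right _ (sq_nonneg _)
        have h6 : 0 ≤ r / (1 + r) ^ 2 := by positivity
        nlinarith
      rw [intervalIntegral.integral_const_mul] at h3
      linarith [integral_inv_one_add_sq_le_one ha hab]
    have h3 : ∫ r in a..b, (wgt r * d r) ^ 2 ≤ 6 / 5 * ∫ r in a..b, wgt r ^ 2 * B r := by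
      rw [← intervalIntegral.integral_const_mul]
      apply intervalIntegral.integral_mono_on hab
        (ContinuousOn.intervalIntegrable_of_Icc hab (by fun_prop))
        (ContinuousOn.intervalIntegrable_of_Icc hab (by fun_prop))
      intro r _
      nlinarith [mul_le_mul_of_nonneg_left (hdB r) (sq_nonneg (wgt r))]
    have h4 : 0 ≤ ∫ r in a..b, (wgt r * d r) ^ 2 :=
      intervalIntegral.integral_nonneg hab fun _ _ => sq_nonneg _
    have h5 := mul_le_mul_of_nonneg_right h2 h4
    rw [hLe, mul_pow]
    linarith
  have key := radial_coercivity ha hab hc hg.1 hEc hBc hpc hqc hec hAd hld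
    (by simp [hA, hs a]) (by simp [hA, hs b]) hla (by simp) hB0 hpA
    (fun z => sq_integral_mul_Gam_sub_le hα (φ' := fun θ => deriv (fun t => f z t) θ)
      (fun θ => (hasDerivAt_snd hfc z θ).differentiableAt.hasDerivAt)
      (hθ'.comp (by fun_prop : Continuous fun θ => (z, θ))))
    heb hLb
  rw [ip_eq ha hab fun z hz θ => by rw [hs z hz, zero_mul],
    ip_eq ha hab fun z hz θ => by rw [hs z hz, zero_mul],
    ip_eq ha hab fun z hz θ => by rw [hDs z hz, zero_mul]]
  have hsq : ∀ (G : ℝ → ℝ → ℝ) z, ∫ θ in (0)..(π / 2), G z θ * wgt z * (G z θ * wgt z) =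
      wgt z ^ 2 * ∫ θ in (0)..(π / 2), G z θ ^ 2 := by
    intro G z
    rw [← intervalIntegral.integral_const_mul]
    congr 1; ext θ; ring
  simp only [hsq]
  refine key.trans_eq (intervalIntegral.integral_congr fun z hz => ?_)
  rw [uIcc_of_le hab] at hz
  have hz0 : 0 < z := ha.trans_le hz.1
  have hI : ∀ G : ℝ → ℝ, Continuous G → IntervalIntegrable G volume 0 (π / 2) :=
    fun G hG => hG.intervalIntegrable _ _
  have hexp : ∫ θ in (0)..(π / 2), LGamT α f z θ * wgt z * (f z θ * wgt z) =
      ∫ θ in (0)..(π / 2), ((((wgt z ^ 2 * (1 - 2 / (1 + z))) * f z θ ^ 2 +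
        (wgt z ^ 2 * z) * (f z θ * fz z θ)) +
        (wgt z ^ 2 * (2 * z ^ 2 / (cGam α * (1 + z) ^ 3) * L -
          2 * z / (cGam α * (1 + z) ^ 2) * L12 f z)) * (f z θ * Gam α θ)) -
        (wgt z ^ 2 * (3 / (1 + z))) * (f z θ * Dth f z θ)) := by
    congr 1; ext θ
    simp only [LGamT, LGam, Lop, Pproj, ← hL, hfz]
    field_simp
    ring
  simp only [hexp]
  rw [intervalIntegral.integral_sub (hI _ (by fun_prop)) (hI _ (by fun_prop)),
    intervalIntegral.integral_add (hI _ (by fun_prop)) (hI _ (by fun_prop)),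
    intervalIntegral.integral_add (hI _ (by fun_prop)) (hI _ (by fun_prop)),
    intervalIntegral.integral_const_mul, intervalIntegral.integral_const_mul,
    intervalIntegral.integral_const_mul, intervalIntegral.integral_const_mul, hl z hz]
  simp only [hA, hE, hp, he]
  ring
end
end
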